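/- Suppose T satisfies a shifted mixing local limit theorem at some scale (L_n). Then T is local-global mixing with respect to 𝔾_U: for every φ ∈ L¹(μ) and every pair (Φ, Φ̄) ∈ 𝔾_U, ∫_X φ · (Φ ∘ T^n) dμ → (∫_X φ dμ) · Φ̄ as n → ∞. -/

import Mathlib

open MeasureTheory Filter Topology

noncomputable section

/-- Euclidean norm of a vector in `ℝ^d`. -/
def rnorm {d : ℕ} (z : Fin d → ℝ) : ℝ := Real.sqrt (∑ i, (z i) ^ 2)

/-- Euclidean norm of a lattice point in `ℤ^d`. -/
def znorm {d : ℕ} (z : Fin d → ℤ) : ℝ := rnorm (fun i => (z i : ℝ))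

variable {d : ℕ} {M : Type*}

/-- The Birkhoff sums `τ_n(y) = ∑_{j<n} τ(f^j y)`. -/
def tauSum (f : M → M) (τ : M → Fin d → ℤ) (n : ℕ) (y : M) : Fin d → ℤ :=
  ∑ j ∈ Finset.range n, τ (f^[j] y)

/-- The skew product `T(y,z) = (f(y), z + τ(y))` on `X = M × ℤ^d`. -/
def skewT (f : M → M) (τ : M → Fin d → ℤ) : M × (Fin d → ℤ) → M × (Fin d → ℤ) :=
  fun x => (f x.1, x.2 + τ x.1)

/-- The measure `μ = ν ⊗ (counting measure on ℤ^d)` on `X = M × ℤ^d`. -/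
def skewMeas [MeasurableSpace M] (ν : Measure M) : Measure (M × (Fin d → ℤ)) :=
  ν.prod (Measure.count : Measure (Fin d → ℤ))

/-- `V_B = M × (B ∩ ℤ^d)` for the box `B = ∏_i [a i, b i] ⊆ ℝ^d`. -/
def VBox (M : Type*) (a b : Fin d → ℝ) : Set (M × (Fin d → ℤ)) :=
  {x | ∀ i, a i ≤ (x.2 i : ℝ) ∧ (x.2 i : ℝ) ≤ b i}

/-- `V_C` for the cube `C` with lower corner `a` and side length `s`. -/
def VCube (M : Type*) (a : Fin d → ℝ) (s : ℝ) : Set (M × (Fin d → ℤ)) :=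
  VBox M a (fun i => a i + s)

/-- Membership in `𝔾_O`:  `Φ` is bounded, uniformly continuous, and has average `Φbar`
along dilations of any fixed box. -/
def memGO [MetricSpace M] [MeasurableSpace M] (μ : Measure (M × (Fin d → ℤ)))
    (Φ : M × (Fin d → ℤ) → ℝ) (Φbar : ℝ) : Prop :=
  (∃ C, ∀ x, |Φ x| ≤ C) ∧ UniformContinuous Φ ∧
    ∀ a b : Fin d → ℝ, (∀ i, a i < b i) →
      Tendsto (fun N : ℝ =>
          (1 / (N ^ d * ∏ i, (b i - a i))) *
            ∫ x in VBox M (fun i => a i * N) (fun i => b i * N), Φ x ∂μ)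
        atTop (𝓝 Φbar)

/-- Membership in `𝔾_U`: `Φ` is bounded, uniformly continuous, and has average `Φbar`
uniformly over all large cubes. -/
def memGU [MetricSpace M] [MeasurableSpace M] (μ : Measure (M × (Fin d → ℤ)))
    (Φ : M × (Fin d → ℤ) → ℝ) (Φbar : ℝ) : Prop :=
  (∃ C, ∀ x, |Φ x| ≤ C) ∧ UniformContinuous Φ ∧
    ∀ ε > (0 : ℝ), ∃ N₀ : ℝ, ∀ (a : Fin d → ℝ) (s : ℝ), N₀ ≤ s →
      |(μ (VCube M a s)).toReal⁻¹ * (∫ x in VCube M a s, Φ x ∂μ) - Φbar| ≤ ε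

/-- The average of `F` over `V_C`, where the cube `C` is encoded by (lower corner, side length). -/
def cubeAvg [MeasurableSpace M] (μ : Measure (M × (Fin d → ℤ)))
    (F : M × (Fin d → ℤ) → ℝ) (c : (Fin d → ℝ) × ℝ) : ℝ :=
  (μ (VCube M c.1 c.2)).toReal⁻¹ * ∫ x in VCube M c.1 c.2, F x ∂μ

/-- The filter of cubes (encoded by (lower corner, side length)) whose side length
tends to infinity. -/
def cubeFilter (d : ℕ) : Filter ((Fin d → ℝ) × ℝ) := Filter.comap Prod.snd atTop

/-- The mixing local limit theorem (MLLT) at scale `L` with limiting density `p`. -/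
def MLLT [TopologicalSpace M] [MeasurableSpace M] (ν : Measure M) (f : M → M) (τ : M → Fin d → ℤ)
    (L : ℕ → ℝ) (p : (Fin d → ℝ) → ℝ) : Prop :=
  Tendsto L atTop atTop ∧ Continuous p ∧ (∀ z, 0 ≤ p z) ∧ (∫ z : Fin d → ℝ, p z) = 1 ∧
    ∀ φ₁ φ₂ : M → ℝ, Continuous φ₁ → Continuous φ₂ →
      (∃ C, ∀ y, |φ₁ y| ≤ C) → (∃ C, ∀ y, |φ₂ y| ≤ C) →
      ∀ z0 : ℕ → Fin d → ℤ,
        Tendsto (fun n => fun i => (z0 n i : ℝ) / L n) atTop (𝓝 0) →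
      ∀ K : ℝ, ∀ ε > (0 : ℝ), ∃ N, ∀ n ≥ N, ∀ z : Fin d → ℝ, rnorm z ≤ K →
        |(L n) ^ d *
            (∫ y, (if tauSum f τ n y = z0 n + (fun i => ⌊z i * L n⌋) then
              φ₁ y * φ₂ (f^[n] y) else 0) ∂ν) -
          (∫ y, φ₁ y ∂ν) * (∫ y, φ₂ y ∂ν) * p z| ≤ ε

/-- The shifted mixing local limit theorem at scale `L` with limiting density `p`. -/
def ShiftedMLLT [TopologicalSpace M] [MeasurableSpace M] (ν : Measure M) (f : M → M) (τ : M → Fin d → ℤ)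
    (L : ℕ → ℝ) (p : (Fin d → ℝ) → ℝ) : Prop :=
  Tendsto L atTop atTop ∧ Continuous p ∧ (∀ z, 0 ≤ p z) ∧ (∫ z : Fin d → ℝ, p z) = 1 ∧
    ∃ D : ℕ → Fin d → ℝ,
    ∀ φ₁ φ₂ : M → ℝ, Continuous φ₁ → Continuous φ₂ →
      (∃ C, ∀ y, |φ₁ y| ≤ C) → (∃ C, ∀ y, |φ₂ y| ≤ C) →
      ∀ z0 : ℕ → Fin d → ℤ,
        Tendsto (fun n => fun i => ((z0 n i : ℝ) - D n i) / L n) atTop (𝓝 0) →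
      ∀ K : ℝ, ∀ ε > (0 : ℝ), ∃ N, ∀ n ≥ N, ∀ z : Fin d → ℝ, rnorm z ≤ K →
        |(L n) ^ d *
            (∫ y, (if tauSum f τ n y = z0 n + (fun i => ⌊z i * L n⌋) then
              φ₁ y * φ₂ (f^[n] y) else 0) ∂ν) -
          (∫ y, φ₁ y ∂ν) * (∫ y, φ₂ y ∂ν) * p z| ≤ ε

end

theorem countable_setOf_reflTransGen {ι : Type*} {R : ι → ι → Prop}
    (h : ∀ a, {b | R a b}.Countable) (a : ι) : {b | Relation.ReflTransGen R a b}.Countable := by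
  let S : ℕ → Set ι := fun n => Nat.rec {a} (fun _ s => ⋃ b ∈ s, {c | R b c}) n
  have hS : ∀ n, (S n).Countable := by
    intro n
    induction n with
    | zero => exact Set.countable_singleton a
    | succ n ih => exact ih.biUnion fun b _ => h b
  refine (Set.countable_iUnion hS).mono fun b hb => ?_
  induction hb with
  | refl => exact Set.mem_iUnion.2 ⟨0, rfl⟩
  | tail _ hbc ih =>
    obtain ⟨n, hn⟩ := Set.mem_iUnion.1 ih
    exact Set.mem_iUnion.2 ⟨n + 1, Set.mem_biUnion hn hbc⟩

theorem exists_open_sigmaCompact_partition (M : Type*) [MetricSpace M] [LocallyCompactSpace M] :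
    ∃ r : M → M → Prop, (∀ i : Quot r, IsOpen (Quot.mk r ⁻¹' {i})) ∧
      ∀ i : Quot r, ∃ K : ℕ → Set M, (∀ n, IsCompact (K n)) ∧ Quot.mk r ⁻¹' {i} = ⋃ n, K n := by
  choose K hK hKx using fun x : M => exists_compact_mem_nhds x
  obtain ⟨v, hvo, hvu, hvf, hvK⟩ := precise_refinement (fun x => interior (K x))
    (fun x => isOpen_interior) (Set.eq_univ_of_forall fun x =>
      Set.mem_iUnion.2 ⟨x, mem_interior_iff_mem_nhds.2 (hKx x)⟩)
  have hvc : ∀ a, IsCompact (closure (v a)) := fun a =>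
    (hK a).of_isClosed_subset isClosed_closure
      (closure_minimal ((hvK a).trans interior_subset) (hK a).isClosed)
  let r : M → M → Prop := fun x y => ∃ a, x ∈ v a ∧ y ∈ v a
  have hopen : ∀ S : Set (Quot r), IsOpen (Quot.mk r ⁻¹' S) := by
    intro S
    refine isOpen_iff_mem_nhds.2 fun x hx => ?_
    obtain ⟨a, ha⟩ := Set.mem_iUnion.1 (hvu ▸ Set.mem_univ x)
    refine mem_of_superset ((hvo a).mem_nhds ha) fun y hy => ?_
    have : Quot.mk r x = Quot.mk r y := Quot.sound ⟨a, ha, hy⟩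
    simpa [← this] using hx
  have hclosed : ∀ S : Set (Quot r), IsClosed (Quot.mk r ⁻¹' S) := fun S =>
    ⟨by simpa using hopen Sᶜ⟩
  refine ⟨r, fun i => hopen _, fun i => ?_⟩
  obtain ⟨x, rfl⟩ := Quot.exists_rep i
  obtain ⟨a, ha⟩ := Set.mem_iUnion.1 (hvu ▸ Set.mem_univ x)
  let R : M → M → Prop := fun a b => (v b ∩ v a).Nonempty
  have hR : ∀ a, {b | R a b}.Countable := fun a =>
    ((hvf.finite_nonempty_inter_compact (hvc a)).subset
      fun b hb => hb.mono (Set.inter_subset_inter_right _ subset_closure)).countable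
  have hA := countable_setOf_reflTransGen hR a
  let T : Set M := ⋃ b ∈ {b | Relation.ReflTransGen R a b}, v b
  have hT1 : ∀ x y, r x y → x ∈ T → y ∈ T := by
    rintro x y ⟨c, hxc, hyc⟩ hx
    obtain ⟨b, hb, hxb⟩ := Set.mem_iUnion₂.1 hx
    exact Set.mem_iUnion₂.2 ⟨c, hb.tail ⟨x, hxc, hxb⟩, hyc⟩
  have hT : ∀ x y, r x y → (x ∈ T) = (y ∈ T) := fun x y h =>
    propext ⟨hT1 x y h, hT1 y x (by obtain ⟨c, h1, h2⟩ := h; exact ⟨c, h2, h1⟩)⟩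
  have hsub : ∀ y, Quot.mk r y = Quot.mk r x → y ∈ T := by
    intro y hy
    have h1 : Quot.lift (· ∈ T) hT (Quot.mk r y) = Quot.lift (· ∈ T) hT (Quot.mk r x) := by rw [hy]
    exact h1.mpr (Set.mem_iUnion₂.2 ⟨a, Relation.ReflTransGen.refl, ha⟩)
  obtain ⟨e, he⟩ := hA.exists_eq_range ⟨a, Relation.ReflTransGen.refl⟩
  refine ⟨fun n => closure (v (e n)) ∩ Quot.mk r ⁻¹' {Quot.mk r x},
    fun n => (hvc _).inter_right (hclosed _), ?_⟩
  rw [← Set.iUnion_inter]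
  refine (Set.inter_eq_right.2 fun y hy => ?_).symm
  obtain ⟨b, hb, hyb⟩ := Set.mem_iUnion₂.1 (hsub y hy)
  rw [he] at hb
  obtain ⟨n, rfl⟩ := hb
  exact Set.mem_iUnion.2 ⟨n, subset_closure hyb⟩

theorem exists_split_of_not_countable_image {X : Type*} [MetricSpace X] [SecondCountableTopology X]
    {h : X → ℝ} (hc : Continuous h) {C : Set X} (hC : IsClosed C) (hu : ¬ (h '' C).Countable)
    {ε : ENNReal} (hε : 0 < ε) :
    ∃ C₀ C₁ : Set X, (IsClosed C₀ ∧ ¬ (h '' C₀).Countable ∧ C₀ ⊆ C ∧ Metric.ediam C₀ ≤ ε) ∧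
      (IsClosed C₁ ∧ ¬ (h '' C₁).Countable ∧ C₁ ⊆ C ∧ Metric.ediam C₁ ≤ ε) ∧
      Disjoint (h '' C₀) (h '' C₁) := by
  -- shrinking the diameter of a closed set with uncountable image
  have small : ∀ D : Set X, IsClosed D → ¬ (h '' D).Countable →
      ∃ E, IsClosed E ∧ ¬ (h '' E).Countable ∧ E ⊆ D ∧ Metric.ediam E ≤ ε := by
    intro D hD hDu
    by_contra! hcon
    apply hDu
    obtain ⟨t, ht, htu⟩ := TopologicalSpace.countable_cover_nhds
      (fun x : X => Metric.closedEBall_mem_nhds x (ENNReal.half_pos hε.ne'))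
    have : h '' D = ⋃ x ∈ t, h '' (Metric.closedEBall x (ε / 2) ∩ D) := by
      rw [← Set.image_iUnion₂, ← Set.iUnion₂_inter, htu, Set.univ_inter]
    rw [this]
    refine ht.biUnion fun x _ => ?_
    by_contra hx
    refine absurd (hcon _ (Metric.isClosed_closedEBall.inter hD) hx Set.inter_subset_right)
      (not_lt.2 ?_)
    refine (Metric.ediam_mono Set.inter_subset_left).trans (Metric.ediam_closedEBall_le.trans ?_)
    rw [ENNReal.mul_div_cancel] <;> simp
  -- two separated pieces with uncountable image
  have key : ∃ r : ℝ, ¬ (h '' C ∩ Set.Iic r).Countable ∧ ∃ s, r < s ∧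
      ¬ (h '' C ∩ Set.Ici s).Countable := by
    let A := h '' C
    let B : Set ℝ := {x ∈ A | ∃ U ∈ 𝓝 x, (A ∩ U).Countable}
    have hB : B.Countable := by
      choose! U hU hUc using fun x (hx : x ∈ B) => hx.2
      obtain ⟨t, htB, ht, hcov⟩ := TopologicalSpace.countable_cover_nhdsWithin
        (f := U) (s := B) fun x hx => mem_nhdsWithin_of_mem_nhds (hU x hx)
      refine (ht.biUnion fun x hx => hUc x (htB hx)).mono fun y hy => ?_
      obtain ⟨x, hx, hyx⟩ := Set.mem_iUnion₂.1 (hcov hy)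
      exact Set.mem_iUnion₂.2 ⟨x, hx, hy.1, hyx⟩
    have hAB : ¬ (A \ B).Countable := fun hcon =>
      hu ((hcon.union hB).mono fun x hx =>
        (em (x ∈ B)).elim Or.inr fun hxB => Or.inl ⟨hx, hxB⟩)
    have hcond : ∀ x ∈ A \ B, ∀ U ∈ 𝓝 x, ¬ (A ∩ U).Countable := fun x hx U hU hcon =>
      hx.2 ⟨hx.1, U, hU, hcon⟩
    have hnt : (A \ B).Nontrivial := by
      rw [← Set.not_subsingleton_iff]
      exact fun hs => hAB hs.countable
    obtain ⟨a, ha, b, hb, hab⟩ := hnt.exists_lt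
    obtain ⟨r, har, hrb⟩ := exists_between hab
    obtain ⟨s, hrs, hsb⟩ := exists_between hrb
    exact ⟨r, hcond a ha _ (Iic_mem_nhds har), s, hrs, hcond b hb _ (Ici_mem_nhds hsb)⟩
  obtain ⟨r, hr, s, hrs, hs⟩ := key
  obtain ⟨C₀, h1, h2, h3, h4⟩ := small (C ∩ h ⁻¹' Set.Iic r) (hC.inter (isClosed_Iic.preimage hc))
    (by rwa [Set.image_inter_preimage])
  obtain ⟨C₁, k1, k2, k3, k4⟩ := small (C ∩ h ⁻¹' Set.Ici s) (hC.inter (isClosed_Ici.preimage hc))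
    (by rwa [Set.image_inter_preimage])
  refine ⟨C₀, C₁, ⟨h1, h2, h3.trans Set.inter_subset_left, h4⟩,
    ⟨k1, k2, k3.trans Set.inter_subset_left, k4⟩, ?_⟩
  rw [Set.disjoint_left]
  rintro _ ⟨x, hx, rfl⟩ ⟨y, hy, hxy⟩
  have := (h3 hx).2
  have := (k3 hy).2
  simp only [Set.mem_preimage, Set.mem_Iic, Set.mem_Ici] at *
  linarith
universe u

open CantorScheme in
theorem exists_injection_range_of_not_countable {X : Type*} [MetricSpace X] [CompleteSpace X]
    [SecondCountableTopology X] {h : X → ℝ} (hc : Continuous h) (hu : ¬ (Set.range h).Countable) :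
    ∃ ψ : (ℕ → Bool) → ℝ, Set.range ψ ⊆ Set.range h ∧ Function.Injective ψ := by
  obtain ⟨u, -, upos', hu0⟩ := exists_seq_strictAnti_tendsto' (zero_lt_one' ENNReal)
  have upos := fun n => (upos' n).1
  let P := Subtype fun E : Set X => IsClosed E ∧ ¬ (h '' E).Countable
  choose C0 C1 h0 h1 hdisj using
    fun {C : Set X} (hC : IsClosed C) (hunc : ¬ (h '' C).Countable) {ε : ENNReal} (hε : 0 < ε) =>
    exists_split_of_not_countable_image hc hC hunc hε
  let DP : List Bool → P := fun l => by
    induction l with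
    | nil => exact ⟨Set.univ, isClosed_univ, by rwa [Set.image_univ]⟩
    | cons a l ih =>
      cases a
      · use C0 ih.property.1 ih.property.2 (upos (l.length + 1))
        exact ⟨(h0 _ _ _).1, (h0 _ _ _).2.1⟩
      use C1 ih.property.1 ih.property.2 (upos (l.length + 1))
      exact ⟨(h1 _ _ _).1, (h1 _ _ _).2.1⟩
  let D : List Bool → Set X := fun l => (DP l).val
  have hanti : ClosureAntitone D := by
    refine Antitone.closureAntitone ?_ fun l => (DP l).property.1
    intro l a
    cases a
    · exact (h0 _ _ _).2.2.1
    exact (h1 _ _ _).2.2.1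
  have hdiam : VanishingDiam D := by
    intro x
    apply tendsto_of_tendsto_of_tendsto_of_le_of_le' tendsto_const_nhds hu0
    · simp
    rw [eventually_atTop]
    refine ⟨1, fun m (hm : 1 ≤ m) => ?_⟩
    rw [Nat.one_le_iff_ne_zero] at hm
    rcases Nat.exists_eq_succ_of_ne_zero hm with ⟨n, rfl⟩
    dsimp
    cases x n
    · convert! (h0 _ _ _).2.2.2
      rw [PiNat.res_length]
    convert! (h1 _ _ _).2.2.2
    rw [PiNat.res_length]
  have hdisj' : CantorScheme.Disjoint fun l => h '' D l := by
    rintro l (a | a) (b | b) hab <;> try contradiction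
    · exact hdisj _ _ _
    exact (hdisj _ _ _).symm
  have hne : ∀ l, (D l).Nonempty := fun l => by
    by_contra hcon
    rw [Set.not_nonempty_iff_eq_empty] at hcon
    exact (DP l).property.2 (by change (h '' D l).Countable; simp [hcon])
  have hdomD : ∀ x : ℕ → Bool, x ∈ (inducedMap D).1 := fun x => by
    rw [hanti.map_of_vanishingDiam hdiam hne]
    trivial
  have hdom : ∀ x : ℕ → Bool, x ∈ (inducedMap fun l => h '' D l).1 := fun x =>
    ⟨h ((inducedMap D).2 ⟨x, hdomD x⟩), Set.mem_iInter.2 fun n =>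
      Set.mem_image_of_mem h (map_mem ⟨x, hdomD x⟩ n)⟩
  refine ⟨fun x => (inducedMap fun l => h '' D l).2 ⟨x, hdom x⟩, ?_, ?_⟩
  · rintro _ ⟨x, rfl⟩
    exact Set.image_subset_range _ _ (map_mem (A := fun l => h '' D l) ⟨x, hdom x⟩ 0)
  · intro x y hxy
    simpa only [← Subtype.val_inj] using hdisj'.map_injective hxy

/-- A map from a Polish space to a set, all of whose fibre unions are Borel, has countable range. -/
theorem countable_range_of_forall_measurableSet_preimage {X I : Type*} [TopologicalSpace X]
    [PolishSpace X] [MeasurableSpace X] [BorelSpace X] (g : X → I)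
    (hg : ∀ S : Set I, MeasurableSet (g ⁻¹' S)) : (Set.range g).Countable := by
  rcases isEmpty_or_nonempty X with hX | hX
  · rw [Set.range_eq_empty]; exact Set.countable_empty
  by_contra hu
  let sec : I → X := Function.invFun g
  have hsec : ∀ x, g (sec (g x)) = g x := fun x => Function.invFun_eq ⟨x, rfl⟩
  obtain ⟨e, he⟩ := exists_measurableEmbedding_real X
  let h : X → ℝ := fun x => e (sec (g x))
  have hgh : ∀ x y, h x = h y → g x = g y := fun x y hxy => by
    rw [← hsec x, ← hsec y, he.injective hxy]
  have hm : Measurable h := fun S _ => hg ((fun i => e (sec i)) ⁻¹' S)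
  have hhu : ¬ (Set.range h).Countable := by
    intro hcon
    apply hu
    have hsub : Set.range g ⊆ (fun r => g (Function.invFun h r)) '' Set.range h := by
      rintro _ ⟨x, rfl⟩
      exact ⟨h x, ⟨x, rfl⟩, hgh _ _ (Function.invFun_eq ⟨x, rfl⟩)⟩
    exact (hcon.image _).mono hsub
  obtain ⟨ψ, hψ, hψi⟩ : ∃ ψ : (ℕ → Bool) → ℝ, Set.range ψ ⊆ Set.range h ∧ Function.Injective ψ := by
    obtain ⟨t', -, hc, hP⟩ := hm.exists_continuous
    let := t'
    let := TopologicalSpace.upgradeIsCompletelyMetrizable X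
    exact exists_injection_range_of_not_countable hc hhu
  have hinj : Function.Injective
      fun S : Set (ℕ → Bool) => (⟨h ⁻¹' (ψ '' S), hg ((fun i => e (sec i)) ⁻¹' (ψ '' S))⟩ :
        {s : Set X // MeasurableSet s}) := by
    intro S T hST
    have h1 : h ⁻¹' (ψ '' S) = h ⁻¹' (ψ '' T) := congrArg Subtype.val hST
    have h2 : ψ '' S = ψ '' T := by
      rwa [Set.preimage_eq_preimage'] at h1
      all_goals exact (Set.image_subset_range _ _).trans hψ
    exact hψi.image_injective h2
  have hcard := Cardinal.lift_mk_le_lift_mk_of_injective hinj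
  have hle : Cardinal.mk {s : Set X // MeasurableSet s} ≤ Cardinal.continuum := by
    have hgen := borel_eq_generateFrom_of_subbasis
      (TopologicalSpace.isBasis_countableBasis X).eq_generateFrom
    rw [← BorelSpace.measurable_eq (α := X)] at hgen
    rw [hgen]
    exact MeasurableSpace.cardinal_measurableSet_le_continuum
      ((Cardinal.le_aleph0_iff_set_countable.2 (TopologicalSpace.countable_countableBasis X)).trans
        Cardinal.aleph0_le_continuum)
  have h3 : Cardinal.mk (Set (ℕ → Bool)) = 2 ^ Cardinal.continuum := by
    simp [Cardinal.mk_set]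
  rw [h3] at hcard
  have h4 := hcard.trans (Cardinal.lift_le.2 hle)
  simp only [Cardinal.lift_power, Cardinal.lift_two, Cardinal.lift_continuum] at h4
  exact absurd h4 (not_le.2 (Cardinal.cantor _))

theorem exists_free_coloring {I : Type u} (V : I → Set I) (hc : ∀ i, (V i).Countable)
    (hr : ∀ i, i ∈ V i) (ht : ∀ i, ∀ j ∈ V i, V j ⊆ V i) :
    ∃ (c : I → Ordinal.{u}) (e : I → ℕ), (∀ i, c i < Ordinal.omega 1) ∧
      ∀ i, ∀ j ∈ V i, c i = c j → e i = e j → i = j := by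
  obtain ⟨_, hwf⟩ := exists_wellFoundedLT I
  have hne : ∀ i, {x | i ∈ V x}.Nonempty := fun i => ⟨i, hr i⟩
  let st : I → I := fun i => wellFounded_lt.min {x | i ∈ V x} (hne i)
  have hst : ∀ i, i ∈ V (st i) := fun i => wellFounded_lt.min_mem {x | i ∈ V x} (hne i)
  have hmin : ∀ i x, i ∈ V x → st i ≤ x := fun i x hx =>
    not_lt.1 (wellFounded_lt.not_lt_min {x | i ∈ V x} hx)
  let r : I → I → Prop := fun j i => j ∈ V i ∧ st j < st i
  have hrw : IsWellFounded I r := ⟨Subrelation.wf (fun h => h.2) (InvImage.wf st wellFounded_lt)⟩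
  choose k hk using fun x => Set.countable_iff_exists_injOn.1 (hc x)
  refine ⟨IsWellFounded.rank r, fun i => k (st i) i, fun i => ?_, fun i j hj hcij heij => ?_⟩
  · induction i using hrw.wf.induction with
    | _ i ih =>
      rw [IsWellFounded.rank_eq]
      have : Countable {b // r b i} := ((hc i).mono fun b (hb : r b i) => hb.1).to_subtype
      refine Ordinal.iSup_lt_omega_one fun b => ?_
      exact (Cardinal.isSuccLimit_omega 1).succ_lt (ih b b.2)
  · rcases (hmin j (st i) (ht _ _ (hst i) hj)).lt_or_eq with hlt | heq
    · exact absurd hcij (IsWellFounded.rank_lt_of_rel (r := r) ⟨hj, hlt⟩).ne'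
    · simp only [heq] at heij
      exact hk (st i) (hst i) (heq ▸ hst j) heij

/-- **Ulam**: a finite measure for which all preimages under a map to `ω₁` are measurable
is carried by countably many fibres. -/
theorem exists_countable_ae_mem_of_lt_omega_one {X : Type*} [MeasurableSpace X] (μ : Measure X)
    [IsFiniteMeasure μ] (c : X → Ordinal.{u}) (hc : ∀ x, c x < Ordinal.omega 1)
    (hm : ∀ S : Set Ordinal.{u}, MeasurableSet (c ⁻¹' S)) :
    ∃ S : Set Ordinal.{u}, S.Countable ∧ ∀ᵐ x ∂μ, c x ∈ S := by
  let W := Set.Iio (Ordinal.omega.{u} 1)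
  let S : Set W := {α | 0 < μ (c ⁻¹' {α.1})}
  have hS : S.Countable := Measure.countable_meas_pos_of_disjoint_iUnion
    (fun α => hm _) (fun α β hαβ => Set.disjoint_left.2 fun x hx hy => hαβ
      (Subtype.ext (hx.symm.trans hy)))
  refine ⟨Subtype.val '' S, hS.image _, ?_⟩
  by_contra hcon
  let B : Set X := c ⁻¹' (Subtype.val '' S)ᶜ
  have hB : 0 < μ B := pos_iff_ne_zero.2 hcon
  have hpt : ∀ α ∈ W, μ (B ∩ c ⁻¹' {α}) = 0 := by
    intro α hα
    by_cases h : (⟨α, hα⟩ : W) ∈ S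
    · have : B ∩ c ⁻¹' {α} = ∅ := by
        ext x
        simp only [Set.mem_inter_iff, Set.mem_empty_iff_false, iff_false, not_and]
        intro hx hxa
        exact hx ⟨⟨α, hα⟩, h, hxa.symm⟩
      simp [this]
    · exact measure_mono_null Set.inter_subset_right (not_not.1 fun h' => h (pos_iff_ne_zero.2 h'))
  have hcount : ∀ α ∈ W, (Set.Iio α).Countable := fun α hα => by
    rw [← Cardinal.le_aleph0_iff_set_countable, Cardinal.mk_Iio_ordinal,
      Cardinal.lift_le_aleph0, ← Cardinal.lt_aleph_one_iff]
    exact Cardinal.lt_ord.1 (by simpa using Set.mem_Iio.1 hα)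
  have hW : ¬ (Set.univ : Set W).Countable := by
    rw [Set.countable_univ_iff, Set.countable_coe_iff, ← Cardinal.le_aleph0_iff_set_countable,
      Cardinal.mk_Iio_ordinal]
    simp
  have hinj : ∀ β : Ordinal.{u}, ∃ g : Ordinal.{u} → ℕ, β ∈ W → Set.InjOn g (Set.Iio β) := by
    intro β
    by_cases hβ : β ∈ W
    · obtain ⟨g, hg⟩ := Set.countable_iff_exists_injOn.1 (hcount β hβ)
      exact ⟨g, fun _ => hg⟩
    · exact ⟨fun _ => 0, fun h => absurd h hβ⟩
  choose g hg using hinj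
  let U : W → ℕ → Set X := fun α n => B ∩ c ⁻¹' {β | α.1 < β ∧ g β α.1 = n}
  have hUm : ∀ α n, MeasurableSet (U α n) := fun α n => (hm _).inter (hm _)
  have hpos : ∀ α : W, ∃ n, 0 < μ (U α n) := by
    intro α
    by_contra! hzero
    have hcov : B ⊆ (⋃ n, U α n) ∪ ⋃ β ∈ Set.Iio α.1 ∪ {α.1}, B ∩ c ⁻¹' {β} := by
      intro x hx
      rcases lt_or_ge α.1 (c x) with h | h
      · exact Or.inl (Set.mem_iUnion.2 ⟨_, hx, h, rfl⟩)
      · refine Or.inr (Set.mem_iUnion₂.2 ⟨c x, ?_, hx, rfl⟩)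
        rcases h.lt_or_eq with h | h
        · exact Or.inl h
        · exact Or.inr h
    refine hB.ne' (measure_mono_null hcov (measure_union_null (measure_iUnion_null fun n =>
      le_antisymm (hzero n) bot_le) ((measure_biUnion_null_iff
        ((hcount _ α.2).union (Set.countable_singleton _))).2 fun β hβ => hpt β ?_)))
    rcases hβ with h | h
    · exact (Set.mem_Iio.1 h).trans α.2
    · rw [Set.mem_singleton_iff.1 h]; exact α.2
  choose n hn using hpos
  apply hW
  have : (Set.univ : Set W) = ⋃ k, {α | n α = k} := by ext; simp
  rw [this]
  refine Set.countable_iUnion fun k => ?_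
  refine (Measure.countable_meas_pos_of_disjoint_iUnion (μ := μ) (As := fun α => U α k)
    (fun α => hUm α k) ?_).mono fun α (hα : n α = k) => hα ▸ hn α
  intro α β hαβ
  refine Set.disjoint_left.2 fun x hx hy => hαβ (Subtype.ext ?_)
  exact hg (c x) (hc x) hx.2.1 hy.2.1 (hx.2.2.trans hy.2.2.symm)

/-- Any partition into open σ-compact sets is carried, up to a null set, by countably many unions
of parts none of which can be split further into two unions of parts of positive measure. -/
theorem exists_countable_atoms {M : Type u} [MetricSpace M] [MeasurableSpace M] [BorelSpace M]
    {I : Type u} (q : M → I) (hopen : ∀ i, IsOpen (q ⁻¹' {i}))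
    (hσ : ∀ i, ∃ K : ℕ → Set M, (∀ n, IsCompact (K n)) ∧ q ⁻¹' {i} = ⋃ n, K n)
    (ν : Measure M) [IsFiniteMeasure ν] {f : M → M} (hf : Measurable f)
    (hmix : ∀ A B : Set I, ν (q ⁻¹' A) ≠ 0 → ν (q ⁻¹' B) ≠ 0 →
      ∃ n x, q x ∈ A ∧ q (f^[n] x) ∈ B) :
    ∃ (κ : I → Ordinal.{u} × ℕ) (S : Set (Ordinal.{u} × ℕ)), S.Countable ∧
      (∀ᵐ x ∂ν, κ (q x) ∈ S) ∧
      ∀ j, ∀ B : Set I, ν (q ⁻¹' (κ ⁻¹' {j} ∩ B)) = 0 ∨ ν (q ⁻¹' (κ ⁻¹' {j} \ B)) = 0 := by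
  have hopen' : ∀ S : Set I, IsOpen (q ⁻¹' S) := fun S => by
    rw [← Set.biUnion_preimage_singleton]
    exact isOpen_biUnion fun i _ => hopen i
  have hmeas : ∀ S : Set I, MeasurableSet (q ⁻¹' S) := fun S => (hopen' S).measurableSet
  let R : I → I → Prop := fun i j => ∃ x, q x = i ∧ q (f x) = j
  have hR : ∀ i, {j | R i j}.Countable := by
    intro i
    obtain ⟨K, hK, hKi⟩ := hσ i
    have hcov : {j | R i j} ⊆ ⋃ n, Set.range fun x : K n => q (f x) := by
      rintro j ⟨x, hx, hj⟩
      have hxK : x ∈ ⋃ n, K n := hKi ▸ hx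
      obtain ⟨n, hn⟩ := Set.mem_iUnion.1 hxK
      exact Set.mem_iUnion.2 ⟨n, ⟨x, hn⟩, hj⟩
    refine (Set.countable_iUnion fun n => ?_).mono hcov
    have : CompactSpace (K n) := isCompact_iff_compactSpace.1 (hK n)
    exact countable_range_of_forall_measurableSet_preimage (fun x : K n => q (f x)) fun S =>
      (hf.comp measurable_subtype_coe) (hmeas S)
  obtain ⟨c, e, hc, hce⟩ := exists_free_coloring (fun i => {j | Relation.ReflTransGen R i j})
    (fun i => countable_setOf_reflTransGen hR i) (fun i => Relation.ReflTransGen.refl)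
    (fun i j hj k hk => Relation.ReflTransGen.trans hj hk)
  have hreach : ∀ n x, Relation.ReflTransGen R (q x) (q (f^[n] x)) := by
    intro n x
    induction n with
    | zero => exact Relation.ReflTransGen.refl
    | succ n ih =>
      rw [Function.iterate_succ_apply']
      exact ih.tail ⟨_, rfl, rfl⟩
  obtain ⟨S, hS, hSν⟩ := exists_countable_ae_mem_of_lt_omega_one ν (fun x => c (q x))
    (fun x => hc _) (fun S => hmeas (c ⁻¹' S))
  refine ⟨fun i => (c i, e i), S ×ˢ Set.univ, hS.prod Set.countable_univ, ?_, fun j B => ?_⟩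
  · filter_upwards [hSν] with x hx using ⟨hx, trivial⟩
  · by_contra! hcon
    obtain ⟨n, x, hx, hy⟩ := hmix _ _ hcon.1 hcon.2
    have hκ := hx.1.trans hy.1.symm
    have := hce _ _ (hreach n x) (congrArg Prod.fst hκ) (congrArg Prod.snd hκ)
    exact hy.2 (this ▸ hx.2)

/-- Under a mixing condition on clopen sets, a uniformly continuous family of functions indexed by
a countable set is almost everywhere approximated by its values along a sequence of points. -/
theorem exists_seq_ae_approx {M W : Type*} [MetricSpace M] [LocallyCompactSpace M]
    [MeasurableSpace M] [BorelSpace M] [Countable W]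
    (ν : Measure M) [IsProbabilityMeasure ν] {f : M → M} (hf : Measurable f)
    (hmix : ∀ A B : Set M, IsClopen A → IsClopen B → ν A ≠ 0 → ν B ≠ 0 →
      ∃ n, ∃ x ∈ A, f^[n] x ∈ B)
    (Φ : M → W → ℝ)
    (hΦ : ∀ ε > 0, ∃ δ > 0, ∀ x y, dist x y < δ → ∀ w, |Φ x w - Φ y w| < ε) :
    ∃ s : ℕ → M, ∀ᵐ x ∂ν, ∀ ε > 0, ∃ k, ∀ w, |Φ x w - Φ (s k) w| < ε := by
  have hMne : Nonempty M := nonempty_of_isProbabilityMeasure ν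
  obtain ⟨r, hopen, hσ⟩ := exists_open_sigmaCompact_partition M
  let q : M → Quot r := Quot.mk r
  have hclopen : ∀ S : Set (Quot r), IsClopen (q ⁻¹' S) := fun S => by
    have hop : ∀ S : Set (Quot r), IsOpen (q ⁻¹' S) := fun S => by
      rw [← Set.biUnion_preimage_singleton]
      exact isOpen_biUnion fun i _ => hopen i
    exact ⟨⟨hop Sᶜ⟩, hop S⟩
  obtain ⟨κ, S, hS, hSν, hatom⟩ := exists_countable_atoms q hopen hσ ν hf
    fun A B hA hB => hmix _ _ (hclopen A) (hclopen B) hA hB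
  have hd : ∀ i : Quot r, ∃ t : ℕ → M, q ⁻¹' {i} ⊆ closure (Set.range t) := by
    intro i
    obtain ⟨K, hK, hKi⟩ := hσ i
    have hsep : TopologicalSpace.IsSeparable (q ⁻¹' {i}) := by
      change TopologicalSpace.IsSeparable (Quot.mk r ⁻¹' {i})
      rw [hKi]
      exact TopologicalSpace.IsSeparable.iUnion fun n => (hK n).isSeparable
    obtain ⟨t, ht, hts⟩ := hsep
    obtain ⟨u, hu⟩ := (ht.insert hMne.some).exists_eq_range (Set.insert_nonempty _ _)
    exact ⟨u, hts.trans (closure_mono (hu ▸ Set.subset_insert _ _))⟩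
  choose t ht using hd
  let F : Quot r → ℕ → W → ℝ := fun i m w => Φ (t i m) w
  have hconst : ∀ j, ∃ i₀ : Quot r, ∀ᵐ x ∂ν, κ (q x) = j → F (q x) = F i₀ := by
    intro j
    have hm : MeasurableSet (q ⁻¹' (κ ⁻¹' {j})) := (hclopen _).isOpen.measurableSet
    obtain ⟨a, ha⟩ := Filter.exists_eventuallyEq_const_of_forall_separating
      (l := ae (ν.restrict (q ⁻¹' (κ ⁻¹' {j})))) (f := fun x => F (q x)) MeasurableSet (by
        intro U _
        have hB := hatom j (F ⁻¹' U)
        rw [ae_restrict_iff' hm, ae_restrict_iff' hm]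
        rcases hB with h | h
        · right
          refine measure_mono_null (fun x hx => ?_) h
          simpa using hx
        · left
          refine measure_mono_null (fun x hx => ?_) h
          simpa using hx)
    have ha' := (ae_restrict_iff' hm).1 ha
    by_cases hex : ∃ x, κ (q x) = j ∧ F (q x) = a
    · obtain ⟨x, -, rfl⟩ := hex
      exact ⟨q x, ha'⟩
    · refine ⟨q hMne.some, ?_⟩
      filter_upwards [ha'] with x hx hxj
      exact absurd ⟨x, hxj, hx hxj⟩ hex
  choose i₀ hi₀ using hconst
  obtain ⟨u, hu⟩ : ∃ u : ℕ → M, ⋃ j ∈ S, Set.range (t (i₀ j)) ⊆ Set.range u := by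
    have hcount : (⋃ j ∈ S, Set.range (t (i₀ j))).Countable :=
      hS.biUnion fun j _ => Set.countable_range _
    obtain ⟨u, hu⟩ := (hcount.insert hMne.some).exists_eq_range (Set.insert_nonempty _ _)
    exact ⟨u, hu ▸ Set.subset_insert _ _⟩
  refine ⟨u, ?_⟩
  filter_upwards [hSν, (ae_ball_iff hS).2 fun j _ => hi₀ j] with x hxS hx ε hε
  obtain ⟨δ, hδ, hΦδ⟩ := hΦ ε hε
  obtain ⟨_, ⟨m, rfl⟩, hm⟩ := Metric.mem_closure_iff.1 (ht (q x) rfl) δ hδ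
  obtain ⟨k, hk⟩ := hu (Set.mem_iUnion₂.2 ⟨_, hxS, m, rfl⟩)
  refine ⟨k, fun w => ?_⟩
  have h1 := congrFun (congrFun (hx _ hxS rfl) m) w
  simp only [F] at h1
  rw [hk, ← h1]
  exact hΦδ _ _ hm w

theorem volume_setOf_add_floor_eq {d : ℕ} {ℓ : ℝ} (hℓ : 0 < ℓ) (k w : Fin d → ℤ) :
    volume {z : Fin d → ℝ | w = k + fun i => ⌊z i * ℓ⌋} = ENNReal.ofReal ((ℓ ^ d)⁻¹) := by
  have hset : {z : Fin d → ℝ | w = k + fun i => ⌊z i * ℓ⌋} =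
      Set.univ.pi fun i => Set.Ico (((w i - k i : ℤ) : ℝ) / ℓ) (((w i - k i : ℤ) + 1 : ℝ) / ℓ) := by
    ext z
    simp only [Set.mem_ofPred_eq, funext_iff, Set.mem_pi, Set.mem_univ, true_imp_iff, Set.mem_Ico,
      div_le_iff₀ hℓ, lt_div_iff₀ hℓ, ← Int.floor_eq_iff, Pi.add_apply]
    exact forall_congr' fun i => by omega
  rw [hset, Real.volume_pi_Ico, ← ENNReal.ofReal_prod_of_nonneg]
  · congr 1
    have : ∀ i : Fin d, ((w i - k i : ℤ) + 1 : ℝ) / ℓ - ((w i - k i : ℤ) : ℝ) / ℓ = ℓ⁻¹ :=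
      fun i => by ring
    rw [Finset.prod_congr rfl fun i _ => this i]
    simp
  · intro i _
    rw [← sub_div]
    exact div_nonneg (by simp) hℓ.le

theorem measurable_add_floor {d : ℕ} (ℓ : ℝ) (k : Fin d → ℤ) :
    Measurable fun z : Fin d → ℝ => k + fun i => ⌊z i * ℓ⌋ := by
  refine measurable_const.add (measurable_pi_lambda _ fun i => ?_)
  have h : Measurable fun z : Fin d → ℝ => z i * ℓ := by fun_prop
  exact Int.measurable_floor.comp h

/-- The density, at the rescaled lattice point of `z`, of the distribution of `t` weighted by
`h`. -/
noncomputable def latticeDensity {d : ℕ} {M : Type*} [MeasurableSpace M] (ν : Measure M) (ℓ : ℝ)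
    (k : Fin d → ℤ) (t : M → Fin d → ℤ) (h : M → ℝ) (z : Fin d → ℝ) : ℝ :=
  ℓ ^ d * ∫ y, (if t y = k + (fun i => ⌊z i * ℓ⌋) then h y else 0) ∂ν

theorem integrable_and_integral_latticeDensity {d : ℕ} {M : Type*} [MeasurableSpace M]
    (ν : Measure M) [IsProbabilityMeasure ν] {ℓ : ℝ} (hℓ : 0 < ℓ) (k : Fin d → ℤ)
    {t : M → Fin d → ℤ} (ht : Measurable t) {h : M → ℝ} (hh : Integrable h ν)
    (c : (Fin d → ℤ) → ℝ) {C : ℝ} (hc : ∀ w, |c w| ≤ C) :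
    Integrable (fun z : Fin d → ℝ => c (k + fun i => ⌊z i * ℓ⌋) * latticeDensity ν ℓ k t h z) ∧
    ∫ z : Fin d → ℝ, c (k + fun i => ⌊z i * ℓ⌋) * latticeDensity ν ℓ k t h z =
      ∫ y, h y * c (t y) ∂ν := by
  have hpos : 0 < ℓ ^ d := pow_pos hℓ d
  have hvol : ∀ w : Fin d → ℤ,
      volume.real {z : Fin d → ℝ | w = k + fun i => ⌊z i * ℓ⌋} = (ℓ ^ d)⁻¹ := fun w => by
    rw [measureReal_def, volume_setOf_add_floor_eq hℓ, ENNReal.toReal_ofReal (by positivity)]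
  have hmg := measurable_add_floor ℓ k
  let F : (Fin d → ℝ) × M → ℝ := fun x =>
    {x : (Fin d → ℝ) × M | t x.2 = k + fun i => ⌊x.1 i * ℓ⌋}.indicator
      (fun x => ℓ ^ d * (h x.2 * c (t x.2))) x
  have hS : MeasurableSet {x : (Fin d → ℝ) × M | t x.2 = k + fun i => ⌊x.1 i * ℓ⌋} :=
    measurableSet_eq_fun (ht.comp measurable_snd) (hmg.comp measurable_fst)
  have hct : Measurable fun y => c (t y) := (measurable_of_countable c).comp ht
  have hhc : Integrable (fun y => h y * c (t y)) ν :=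
    hh.mul_bdd (c := C) hct.aestronglyMeasurable (ae_of_all _ fun y => hc _)
  have hFm : AEStronglyMeasurable F ((volume : Measure (Fin d → ℝ)).prod ν) :=
    ((hhc.1.comp_snd).const_mul _).indicator hS
  have hslice : ∀ y, (fun z => F (z, y)) =
      {z : Fin d → ℝ | t y = k + fun i => ⌊z i * ℓ⌋}.indicator
        fun _ => ℓ ^ d * (h y * c (t y)) := fun y => rfl
  have hSy : ∀ y, MeasurableSet {z : Fin d → ℝ | t y = k + fun i => ⌊z i * ℓ⌋} := fun y =>
    measurableSet_eq_fun measurable_const hmg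
  have hint : ∀ y, ∫ z, F (z, y) = h y * c (t y) := fun y => by
    rw [hslice, integral_indicator_const _ (hSy y), hvol]
    simp only [smul_eq_mul]
    field_simp
  have hintn : ∀ y, ∫ z, ‖F (z, y)‖ = ‖h y * c (t y)‖ := fun y => by
    have : (fun z => ‖F (z, y)‖) = {z : Fin d → ℝ | t y = k + fun i => ⌊z i * ℓ⌋}.indicator
        fun _ => ℓ ^ d * ‖h y * c (t y)‖ := by
      ext z
      rw [congrFun (hslice y) z, norm_indicator_eq_indicator_norm]
      simp [abs_of_pos hℓ]
    rw [this, integral_indicator_const _ (hSy y), hvol]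
    simp only [smul_eq_mul]
    field_simp
  have hFi : Integrable F ((volume : Measure (Fin d → ℝ)).prod ν) := by
    rw [integrable_prod_iff' hFm]
    refine ⟨ae_of_all _ fun y => ?_, ?_⟩
    · rw [hslice, integrable_indicator_iff (hSy y)]
      refine integrableOn_const ?_
      rw [volume_setOf_add_floor_eq hℓ]
      exact ENNReal.ofReal_ne_top
    · simp only [hintn]
      exact hhc.norm
  have hFz : ∀ z, ∫ y, F (z, y) ∂ν =
      c (k + fun i => ⌊z i * ℓ⌋) * latticeDensity ν ℓ k t h z := fun z => by
    rw [latticeDensity, ← integral_const_mul, ← integral_const_mul]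
    refine integral_congr_ae (ae_of_all _ fun y => ?_)
    by_cases hy : t y = k + fun i => ⌊z i * ℓ⌋
    · simp only [F, Set.indicator, Set.mem_ofPred_eq, hy, if_true]
      ring
    · simp [F, Set.indicator, hy]
  simp only [← hFz]
  refine ⟨hFi.integral_prod_left, ?_⟩
  rw [integral_integral_swap hFi]
  simp only [hint]

/-- **Scheffé's lemma** for probability densities. -/
theorem tendsto_integral_abs_sub_of_tendsto_density {α : Type*} [MeasurableSpace α]
    {μ : Measure α} {w : ℕ → α → ℝ} {p : α → ℝ} (hw : ∀ᶠ n in atTop, Integrable (w n) μ)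
    (hp : Integrable p μ) (hw0 : ∀ᶠ n in atTop, ∀ x, 0 ≤ w n x) (hp0 : ∀ x, 0 ≤ p x)
    (hint : ∀ᶠ n in atTop, ∫ x, w n x ∂μ = ∫ x, p x ∂μ)
    (hlim : ∀ x, Tendsto (fun n => w n x) atTop (𝓝 (p x))) :
    Tendsto (fun n => ∫ x, |w n x - p x| ∂μ) atTop (𝓝 0) := by
  have h1 : Tendsto (fun n => ∫ x, max (p x - w n x) 0 ∂μ) atTop (𝓝 (∫ _, (0 : ℝ) ∂μ)) := by
    refine tendsto_integral_filter_of_dominated_convergence p ?_ ?_ hp ?_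
    · filter_upwards [hw] with n hn using (hp.sub hn).pos_part.1
    · filter_upwards [hw0] with n hn
      refine ae_of_all _ fun x => ?_
      rw [Real.norm_of_nonneg (le_max_right _ _)]
      exact max_le (by linarith [hn x]) (hp0 x)
    · refine ae_of_all _ fun x => ?_
      have := (tendsto_const_nhds.sub (hlim x) : Tendsto (fun n => p x - w n x) _ _).max
        (tendsto_const_nhds (x := (0 : ℝ)))
      simpa using this
  rw [integral_zero] at h1
  have h2 := h1.const_mul 2
  rw [mul_zero] at h2
  refine h2.congr' ?_
  filter_upwards [hw, hint] with n hn hi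
  have : ∀ x, |w n x - p x| = 2 * max (p x - w n x) 0 + (w n x - p x) := fun x => by
    rcases le_total (p x) (w n x) with h | h
    · rw [abs_of_nonneg (by linarith), max_eq_right (by linarith)]; ring
    · rw [abs_of_nonpos (by linarith), max_eq_left (by linarith)]; ring
  simp only [this]
  have hpos : Integrable (fun x => 2 * max (p x - w n x) 0) μ := (hp.sub hn).pos_part.const_mul 2
  have hsub : Integrable (fun x => w n x - p x) μ := hn.sub hp
  rw [integral_add hpos hsub, integral_sub hn hp, hi, integral_const_mul]
  simp

theorem tendsto_integral_abs_sub_of_dominated_density {α : Type*} [MeasurableSpace α]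
    {μ : Measure α} {u w : ℕ → α → ℝ} {p : α → ℝ} {C a : ℝ}
    (hu : ∀ᶠ n in atTop, Integrable (u n) μ) (hw : ∀ᶠ n in atTop, Integrable (w n) μ)
    (hp : Integrable p μ) (hp0 : ∀ x, 0 ≤ p x) (hC : 0 ≤ C)
    (huw : ∀ᶠ n in atTop, ∀ x, |u n x| ≤ C * w n x)
    (hlim : ∀ x, Tendsto (fun n => u n x) atTop (𝓝 (a * p x)))
    (hwp : Tendsto (fun n => ∫ x, |w n x - p x| ∂μ) atTop (𝓝 0)) :
    Tendsto (fun n => ∫ x, |u n x - a * p x| ∂μ) atTop (𝓝 0) := by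
  have hmin : ∀ᶠ n in atTop,
      Integrable (fun x => min |u n x - a * p x| ((C + |a|) * p x)) μ := by
    filter_upwards [hu] with n hn using (hn.sub (hp.const_mul a)).abs.inf (hp.const_mul _)
  have h1 : Tendsto (fun n => ∫ x, min |u n x - a * p x| ((C + |a|) * p x) ∂μ) atTop
      (𝓝 (∫ _, (0 : ℝ) ∂μ)) := by
    refine tendsto_integral_filter_of_dominated_convergence (fun x => (C + |a|) * p x)
      (hmin.mono fun n hn => hn.1) ?_ (hp.const_mul _) ?_
    · refine Eventually.of_forall fun n => ae_of_all _ fun x => ?_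
      have h0 : 0 ≤ (C + |a|) * p x := mul_nonneg (by positivity) (hp0 x)
      rw [Real.norm_of_nonneg (le_min (abs_nonneg _) h0)]
      exact min_le_right _ _
    · refine ae_of_all _ fun x => ?_
      have h0 : 0 ≤ (C + |a|) * p x := mul_nonneg (by positivity) (hp0 x)
      have := (((hlim x).sub_const (a * p x)).abs).min (tendsto_const_nhds (x := (C + |a|) * p x))
      simpa [min_eq_left h0] using this
  rw [integral_zero] at h1
  have h2 := (hwp.const_mul C).add h1
  rw [mul_zero, zero_add] at h2
  refine squeeze_zero' (Eventually.of_forall fun n => integral_nonneg fun x => abs_nonneg _) ?_ h2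
  filter_upwards [hu, hw, huw, hmin] with n hn hwn hun hmn
  have hwpi : Integrable (fun x => C * |w n x - p x|) μ := (hwn.sub hp).abs.const_mul C
  rw [← integral_const_mul, ← integral_add hwpi hmn]
  refine integral_mono (hn.sub (hp.const_mul a)).abs (hwpi.add hmn) fun x => ?_
  beta_reduce
  rcases min_choice |u n x - a * p x| ((C + |a|) * p x) with h | h
  · rw [h]
    exact le_add_of_nonneg_left (mul_nonneg hC (abs_nonneg _))
  · rw [h]
    calc |u n x - a * p x| ≤ |u n x| + |a * p x| := abs_sub _ _
      _ ≤ C * w n x + |a| * p x := by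
        rw [abs_mul, abs_of_nonneg (hp0 x)]
        linarith [hun x]
      _ ≤ _ := by
        have := mul_le_mul_of_nonneg_left (le_abs_self (w n x - p x)) hC
        linarith

/-- Functions on the lattice whose averages over large cubes are uniformly close to `b` have
rescaled integrals converging to `b`, against any continuous probability density. -/
theorem tendsto_integral_of_cube_averages {d : ℕ} {L : ℕ → ℝ} (hL : Tendsto L atTop atTop)
    (z0 : ℕ → Fin d → ℤ) {p : (Fin d → ℝ) → ℝ} (hpc : Continuous p) (hp0 : ∀ z, 0 ≤ p z)
    (hp1 : ∫ z, p z = 1) {h : (Fin d → ℤ) → ℝ} {C b : ℝ} (hC : ∀ w, |h w| ≤ C)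
    (hav : ∀ ε > 0, ∃ V : Finset (Fin d → ℤ), V.Nonempty ∧
      ∀ w, |(∑ v ∈ V, h (w + v)) / V.card - b| ≤ ε) :
    Tendsto (fun n => ∫ z : Fin d → ℝ, h (z0 n + fun i => ⌊z i * L n⌋) * p z) atTop (𝓝 b) := by
  have hpi : Integrable p := by
    by_contra hcon
    rw [integral_undef hcon] at hp1
    exact zero_ne_one hp1
  have hC0 : 0 ≤ C := (abs_nonneg _).trans (hC 0)
  have hmeas : ∀ n (v : Fin d → ℤ),
      Measurable fun z : Fin d → ℝ => h ((z0 n + fun i => ⌊z i * L n⌋) + v) := fun n v =>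
    (measurable_of_countable fun w => h (w + v)).comp (measurable_add_floor _ _)
  have hint : ∀ n (v : Fin d → ℤ) {q : (Fin d → ℝ) → ℝ}, Integrable q →
      Integrable fun z : Fin d → ℝ => h ((z0 n + fun i => ⌊z i * L n⌋) + v) * q z :=
    fun n v q hq => hq.bdd_mul (c := C) (hmeas n v).aestronglyMeasurable
      (ae_of_all _ fun z => hC _)
  let J : ℕ → (Fin d → ℤ) → ℝ := fun n v =>
    ∫ z : Fin d → ℝ, h ((z0 n + fun i => ⌊z i * L n⌋) + v) * p z
  have hJ0 : ∀ n, ∫ z : Fin d → ℝ, h (z0 n + fun i => ⌊z i * L n⌋) * p z = J n 0 := fun n => by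
    simp [J]
  simp only [hJ0]
  have hshift : ∀ v, Tendsto (fun n => J n 0 - J n v) atTop (𝓝 0) := by
    intro v
    let s : ℕ → Fin d → ℝ := fun n i => (v i : ℝ) / L n
    have hs : Tendsto s atTop (𝓝 0) := tendsto_pi_nhds.2 fun i => hL.const_div_atTop _
    have hsch := tendsto_integral_abs_sub_of_tendsto_density (μ := volume)
      (w := fun n z => p (z - s n)) (p := p)
      (Eventually.of_forall fun n => hpi.comp_sub_right (s n)) hpi
      (Eventually.of_forall fun n z => hp0 _) hp0
      (Eventually.of_forall fun n => integral_sub_right_eq_self p (s n))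
      (fun z => by
        have : Tendsto (fun n => z - s n) atTop (𝓝 (z - 0)) := tendsto_const_nhds.sub hs
        rw [sub_zero] at this
        exact (hpc.tendsto z).comp this)
    have h2 := hsch.const_mul C
    rw [mul_zero] at h2
    refine squeeze_zero_norm' ?_ h2
    filter_upwards [hL.eventually_gt_atTop 0] with n hn
    have hJv : J n v = ∫ z : Fin d → ℝ, h ((z0 n + fun i => ⌊z i * L n⌋) + 0) * p (z - s n) := by
      rw [← integral_add_right_eq_self _ (s n)]
      refine integral_congr_ae (ae_of_all _ fun z => ?_)
      have : ((z0 n + fun i => ⌊(z + s n) i * L n⌋) : Fin d → ℤ) =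
          (z0 n + fun i => ⌊z i * L n⌋) + v := by
        ext i
        have : (z + s n) i * L n = z i * L n + v i := by
          simp only [Pi.add_apply, s]
          field_simp
        rw [Pi.add_apply, this, Int.floor_add_intCast, Pi.add_apply, Pi.add_apply, add_assoc]
      simp only [this, add_zero, add_sub_cancel_right]
    rw [hJv, ← integral_sub (hint n 0 hpi) (hint n 0 (hpi.comp_sub_right (s n))),
      ← integral_const_mul]
    refine norm_integral_le_of_norm_le (((hpi.comp_sub_right (s n)).sub hpi).abs.const_mul C)
      (ae_of_all _ fun z => ?_)
    rw [← mul_sub, norm_mul, Real.norm_eq_abs, Real.norm_eq_abs, abs_sub_comm]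
    exact mul_le_mul_of_nonneg_right (hC _) (abs_nonneg _)
  rw [Metric.tendsto_atTop']
  intro ε hε
  obtain ⟨V, hV, hVb⟩ := hav (ε / 2) (half_pos hε)
  have hcard : (0 : ℝ) < V.card := by exact_mod_cast hV.card_pos
  have hsum : Tendsto (fun n => (∑ v ∈ V, (J n 0 - J n v)) / V.card) atTop (𝓝 0) := by
    have := (tendsto_finsetSum V fun v _ => hshift v).div_const (V.card : ℝ)
    simpa using this
  have hmain : ∀ n, |(∑ v ∈ V, J n v) / V.card - b| ≤ ε / 2 := by
    intro n
    have : (∑ v ∈ V, J n v) / V.card - b = ∫ z : Fin d → ℝ,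
        ((∑ v ∈ V, h ((z0 n + fun i => ⌊z i * L n⌋) + v)) / V.card - b) * p z := by
      simp only [J, sub_mul, div_mul_eq_mul_div, Finset.sum_mul]
      rw [integral_sub ((integrable_finsetSum V fun v _ => hint n v hpi).div_const _)
        (hpi.const_mul b), integral_div, integral_finsetSum V fun v _ => hint n v hpi,
        integral_const_mul, hp1, mul_one]
    rw [this, ← Real.norm_eq_abs]
    refine (norm_integral_le_of_norm_le (hpi.const_mul (ε / 2)) (ae_of_all _ fun z => ?_)).trans ?_
    · rw [norm_mul, Real.norm_eq_abs, Real.norm_of_nonneg (hp0 z)]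
      exact mul_le_mul_of_nonneg_right (hVb _) (hp0 z)
    · rw [integral_const_mul, hp1, mul_one]
  obtain ⟨N, hN⟩ := (Metric.tendsto_atTop'.1 hsum) (ε / 2) (half_pos hε)
  refine ⟨N, fun n hn => ?_⟩
  have h1 := hN n hn
  rw [Real.dist_0_eq_abs, Finset.sum_sub_distrib, Finset.sum_const, nsmul_eq_mul, sub_div,
    mul_div_cancel_left₀ _ hcard.ne'] at h1
  rw [Real.dist_eq]
  calc |J n 0 - b| = |(J n 0 - (∑ v ∈ V, J n v) / V.card) + ((∑ v ∈ V, J n v) / V.card - b)| := by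
        ring_nf
    _ ≤ _ := abs_add_le _ _
    _ < ε := by linarith [hmain n]

theorem tendsto_integral_mul_comp_sub {d : ℕ} {M : Type*} [MeasurableSpace M]
    {ν : Measure M} [IsProbabilityMeasure ν] {L : ℕ → ℝ} (hL : Tendsto L atTop atTop)
    {z0 : ℕ → Fin d → ℤ} {t : ℕ → M → Fin d → ℤ} (ht : ∀ n, Measurable (t n))
    {p : (Fin d → ℝ) → ℝ} (hp0 : ∀ z, 0 ≤ p z) (hp1 : ∫ z, p z = 1)
    (hlim1 : ∀ z, Tendsto (fun n => latticeDensity ν (L n) (z0 n) (t n) (fun _ => 1) z) atTop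
      (𝓝 (p z)))
    {h : ℕ → M → ℝ} {C a : ℝ} (hh : ∀ n, Integrable (h n) ν) (hC : ∀ n y, |h n y| ≤ C)
    (hlim : ∀ z, Tendsto (fun n => latticeDensity ν (L n) (z0 n) (t n) (h n) z) atTop
      (𝓝 (a * p z)))
    {c : (Fin d → ℤ) → ℝ} {C' : ℝ} (hc : ∀ w, |c w| ≤ C') :
    Tendsto (fun n => ∫ y, h n y * c (t n y) ∂ν -
      a * ∫ z : Fin d → ℝ, c (z0 n + fun i => ⌊z i * L n⌋) * p z) atTop (𝓝 0) := by
  have hpi : Integrable p := by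
    by_contra hcon
    rw [integral_undef hcon] at hp1
    exact zero_ne_one hp1
  have hLpos := hL.eventually_gt_atTop 0
  have hMne : Nonempty M := nonempty_of_isProbabilityMeasure ν
  have hC0 : 0 ≤ C := (abs_nonneg _).trans (hC 0 hMne.some)
  have hdens : ∀ n, 0 < L n → ∀ {g : M → ℝ}, Integrable g ν →
      Integrable (latticeDensity ν (L n) (z0 n) (t n) g) ∧
        ∫ z, latticeDensity ν (L n) (z0 n) (t n) g z = ∫ y, g y ∂ν := fun n hn g hg => by
    simpa using integrable_and_integral_latticeDensity ν hn (z0 n) (ht n) hg (fun _ => 1)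
      (C := 1) (by simp)
  have hwi : ∀ᶠ n in atTop, Integrable (latticeDensity ν (L n) (z0 n) (t n) fun _ => 1) :=
    hLpos.mono fun n hn => (hdens n hn (integrable_const 1)).1
  have hui : ∀ᶠ n in atTop, Integrable (latticeDensity ν (L n) (z0 n) (t n) (h n)) :=
    hLpos.mono fun n hn => (hdens n hn (hh n)).1
  have hwp : Tendsto (fun n => ∫ z, |latticeDensity ν (L n) (z0 n) (t n) (fun _ => 1) z - p z|)
      atTop (𝓝 0) := by
    refine tendsto_integral_abs_sub_of_tendsto_density hwi hpi ?_ hp0 ?_ hlim1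
    · filter_upwards [hLpos] with n hn z
      refine mul_nonneg (pow_nonneg hn.le _) (integral_nonneg fun y => ?_)
      beta_reduce
      split_ifs <;> simp
    · filter_upwards [hLpos] with n hn
      rw [(hdens n hn (integrable_const 1)).2, hp1]
      simp
  have hu := tendsto_integral_abs_sub_of_dominated_density hui hwi hpi hp0 hC0 (by
    filter_upwards [hLpos] with n hn z
    have hpow := pow_nonneg hn.le d
    have hms : MeasurableSet {y | t n y = z0 n + fun i => ⌊z i * L n⌋} :=
      measurableSet_eq_fun (ht n) measurable_const
    have hi : Integrable
        (fun y => if t n y = (z0 n + fun i => ⌊z i * L n⌋) then C else 0) ν :=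
      ((integrable_const C).indicator hms).congr (ae_of_all _ fun y => by simp [Set.indicator])
    have hle : |∫ y, (if t n y = (z0 n + fun i => ⌊z i * L n⌋) then h n y else 0) ∂ν| ≤
        ∫ y, (if t n y = (z0 n + fun i => ⌊z i * L n⌋) then C else 0) ∂ν := by
      rw [← Real.norm_eq_abs]
      refine norm_integral_le_of_norm_le hi (ae_of_all _ fun y => ?_)
      split_ifs
      · exact hC n y
      · simp
    have heq : C * latticeDensity ν (L n) (z0 n) (t n) (fun _ => 1) z = (L n) ^ d *
        ∫ y, (if t n y = (z0 n + fun i => ⌊z i * L n⌋) then C else 0) ∂ν := by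
      rw [latticeDensity, mul_left_comm, ← integral_const_mul]
      simp only [mul_ite, mul_one, mul_zero]
    rw [heq, latticeDensity, abs_mul, abs_of_nonneg hpow]
    exact mul_le_mul_of_nonneg_left hle hpow) hlim hwp
  have h2 := hu.const_mul C'
  rw [mul_zero] at h2
  refine squeeze_zero_norm' ?_ h2
  filter_upwards [hLpos] with n hn
  obtain ⟨h3, h4⟩ := integrable_and_integral_latticeDensity ν hn (z0 n) (ht n) (hh n) c hc
  have hui := (hdens n hn (hh n)).1
  have hcm : Measurable fun z : Fin d → ℝ => c (z0 n + fun i => ⌊z i * L n⌋) :=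
    (measurable_of_countable c).comp (measurable_add_floor _ _)
  have hcp : Integrable fun z : Fin d → ℝ => a * (c (z0 n + fun i => ⌊z i * L n⌋) * p z) :=
    (hpi.bdd_mul (c := C') hcm.aestronglyMeasurable (ae_of_all _ fun z => hc _)).const_mul a
  rw [← h4, ← integral_const_mul, ← integral_sub h3 hcp, ← integral_const_mul]
  refine norm_integral_le_of_norm_le ((hui.sub (hpi.const_mul a)).abs.const_mul C')
    (ae_of_all _ fun z => ?_)
  have : ∀ c' u q : ℝ, c' * u - a * (c' * q) = c' * (u - a * q) := fun _ _ _ => by ring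
  rw [this, norm_mul, Real.norm_eq_abs, Real.norm_eq_abs]
  exact mul_le_mul_of_nonneg_right (hc _) (abs_nonneg _)

theorem exists_sum_approx {M W : Type*} [MetricSpace M] [MeasurableSpace M] [BorelSpace M]
    [Countable W] {ν : Measure M} [IsProbabilityMeasure ν] {Φ : M → W → ℝ}
    (hm : ∀ w, Measurable fun y => Φ y w) {C : ℝ} (hC0 : 0 ≤ C) (hC : ∀ y w, |Φ y w| ≤ C)
    {s : ℕ → M} (hs : ∀ᵐ x ∂ν, ∀ ε > 0, ∃ k, ∀ w, |Φ x w - Φ (s k) w| < ε)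
    {ε : ℝ} (hε : 0 < ε) :
    ∃ (K : ℕ) (χ : ℕ → BoundedContinuousFunction M ℝ) (e : M → ℝ), Integrable e ν ∧
      ∫ y, e y ∂ν ≤ ε ∧
      ∀ y w, |Φ y w - ∑ k ∈ Finset.range K, χ k y * Φ (s k) w| ≤ e y := by
  obtain ⟨δ, hδ, hδε⟩ : ∃ δ > 0, δ * (1 + 2 * C) = ε :=
    ⟨ε / (1 + 2 * C), by positivity, by field_simp⟩
  let A : ℕ → Set M := fun k => {y | ∀ w, |Φ y w - Φ (s k) w| < δ}
  have hA : ∀ k, MeasurableSet (A k) := fun k => by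
    have : A k = ⋂ w, {y | |Φ y w - Φ (s k) w| < δ} := by ext; simp [A]
    rw [this]
    exact MeasurableSet.iInter fun w =>
      measurableSet_lt (((hm w).sub_const _).abs) measurable_const
  have hAν : ν (⋃ k, A k) = 1 := by
    rw [prob_compl_eq_zero_iff (MeasurableSet.iUnion hA) |>.symm]
    refine measure_mono_null ?_ (ae_iff.1 hs)
    intro x hx hcon
    obtain ⟨k, hk⟩ := hcon δ hδ
    exact hx (Set.mem_iUnion.2 ⟨k, hk⟩)
  have hacc : ∀ n, MeasurableSet (Set.accumulate A n) := fun n =>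
    MeasurableSet.iUnion fun k => MeasurableSet.iUnion fun _ => hA k
  obtain ⟨n, hn⟩ : ∃ n, ν.real (Set.accumulate A n)ᶜ ≤ δ := by
    have h1 : Tendsto (fun n => ν.real (Set.accumulate A n)) atTop (𝓝 1) := by
      have := (ENNReal.tendsto_toReal (measure_ne_top ν _)).comp
        (tendsto_measure_iUnion_accumulate (μ := ν) (f := A))
      rwa [hAν, ENNReal.toReal_one] at this
    obtain ⟨n, hn⟩ := (h1.eventually_const_lt (show 1 - δ < 1 by linarith)).exists
    refine ⟨n, ?_⟩
    rw [probReal_compl_eq_one_sub (hacc n)]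
    linarith
  let B : ℕ → Set M := fun k => A k ∩ ⋂ j, ⋂ _ : j < k, (A j)ᶜ
  have hB : ∀ k, MeasurableSet (B k) := fun k =>
    (hA k).inter (MeasurableSet.iInter fun j => MeasurableSet.iInter fun _ => (hA j).compl)
  have hKpos : (0 : ℝ) < (n + 1 : ℕ) := by positivity
  choose χ hχ hχi using fun k => ((integrable_const (1 : ℝ)).indicator (hB k) :
    Integrable ((B k).indicator fun _ => (1 : ℝ)) ν).exists_boundedContinuous_integral_sub_le
      (div_pos hδ hKpos)
  have hUi : Integrable ((Set.accumulate A n)ᶜ.indicator fun _ => C) ν :=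
    (integrable_const C).indicator (hacc n).compl
  have hdi : ∀ k, Integrable (fun y => C * ‖(B k).indicator (fun _ => (1 : ℝ)) y - χ k y‖) ν :=
    fun k => ((((integrable_const (1 : ℝ)).indicator (hB k)).sub (hχi k)).norm).const_mul C
  have hsi := integrable_finsetSum (Finset.range (n + 1)) fun k _ => hdi k
  refine ⟨n + 1, χ, fun y => (δ + (Set.accumulate A n)ᶜ.indicator (fun _ => C) y) +
    ∑ k ∈ Finset.range (n + 1), C * ‖(B k).indicator (fun _ => (1 : ℝ)) y - χ k y‖,
    ((integrable_const δ).add hUi).add hsi, ?_, fun y w => ?_⟩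
  · have hδU : Integrable (fun y => δ + (Set.accumulate A n)ᶜ.indicator (fun _ => C) y) ν :=
      (integrable_const δ).add hUi
    rw [integral_add hδU hsi, integral_add (integrable_const δ) hUi,
      integral_indicator_const _ (hacc n).compl,
      integral_finsetSum _ fun k _ => hdi k]
    have h1 : ∑ k ∈ Finset.range (n + 1),
        ∫ y, C * ‖(B k).indicator (fun _ => (1 : ℝ)) y - χ k y‖ ∂ν ≤ C * δ := by
      calc _ ≤ ∑ k ∈ Finset.range (n + 1), C * (δ / (n + 1 : ℕ)) :=
            Finset.sum_le_sum fun k _ => by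
              rw [integral_const_mul]
              exact mul_le_mul_of_nonneg_left (hχ k) hC0
        _ = C * δ := by
          rw [Finset.sum_const, Finset.card_range, nsmul_eq_mul]
          field_simp
    have h2 : ν.real (Set.accumulate A n)ᶜ * C ≤ δ * C := mul_le_mul_of_nonneg_right hn hC0
    simp only [integral_const, probReal_univ, smul_eq_mul, one_mul]
    linarith
  · have hsplit : Φ y w - ∑ k ∈ Finset.range (n + 1), χ k y * Φ (s k) w =
        (Φ y w - ∑ k ∈ Finset.range (n + 1), (B k).indicator (fun _ => (1 : ℝ)) y * Φ (s k) w) +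
        ∑ k ∈ Finset.range (n + 1),
          ((B k).indicator (fun _ => (1 : ℝ)) y - χ k y) * Φ (s k) w := by
      simp only [sub_mul, Finset.sum_sub_distrib]
      ring
    rw [hsplit]
    refine (abs_add_le _ _).trans (add_le_add ?_ ?_)
    · by_cases hy : y ∈ Set.accumulate A n
      · rw [Set.indicator_of_notMem (Set.notMem_compl_iff.2 hy), add_zero]
        have hex : ∃ k, y ∈ A k := by
          obtain ⟨k, -, hk⟩ := Set.mem_accumulate.1 hy
          exact ⟨k, hk⟩
        classical
        have hjA := Nat.find_spec hex
        have hjmin := fun m => Nat.find_min (H := hex) (m := m)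
        set j := Nat.find hex with hj
        have hjn : j ≤ n := by
          obtain ⟨k, hkn, hk⟩ := Set.mem_accumulate.1 hy
          exact (Nat.find_min' hex hk).trans hkn
        have hjB : y ∈ B j := ⟨hjA, Set.mem_iInter₂.2 fun m hm => hjmin m hm⟩
        rw [Finset.sum_eq_single j]
        · rw [Set.indicator_of_mem hjB, one_mul]
          exact (hjA w).le
        · intro k _ hkj
          rw [Set.indicator_of_notMem, zero_mul]
          intro hk
          rcases lt_or_gt_of_ne hkj with h | h
          · exact hjmin k h hk.1
          · exact Set.mem_iInter₂.1 hk.2 j h hjA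
        · intro h
          exact absurd (Finset.mem_range.2 (Nat.lt_succ_of_le hjn)) h
      · rw [Set.indicator_of_mem (show y ∈ (Set.accumulate A n)ᶜ from hy),
          Finset.sum_eq_zero, sub_zero]
        · linarith [hC y w]
        · intro k hk
          rw [Set.indicator_of_notMem, zero_mul]
          exact fun h => hy (Set.mem_accumulate.2
            ⟨k, Nat.lt_succ_iff.1 (Finset.mem_range.1 hk), h.1⟩)
    · refine (Finset.abs_sum_le_sum_abs _ _).trans (Finset.sum_le_sum fun k _ => ?_)
      rw [abs_mul, mul_comm, ← Real.norm_eq_abs (_ - _)]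
      exact mul_le_mul_of_nonneg_right (hC _ _) (norm_nonneg _)

theorem tendsto_integral_boundedContinuous_mul {d : ℕ} {M : Type*} [MetricSpace M]
    [MeasurableSpace M] [BorelSpace M] {ν : Measure M} [IsProbabilityMeasure ν]
    {f : M → M} (hf : MeasurePreserving f ν ν) {L : ℕ → ℝ} (hL : Tendsto L atTop atTop)
    {z0 : ℕ → Fin d → ℤ} {t : ℕ → M → Fin d → ℤ} (ht : ∀ n, Measurable (t n))
    {p : (Fin d → ℝ) → ℝ} (hpc : Continuous p) (hp0 : ∀ z, 0 ≤ p z) (hp1 : ∫ z, p z = 1)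
    (hM : ∀ (φ₁ φ₂ : BoundedContinuousFunction M ℝ) (z : Fin d → ℝ),
      Tendsto (fun n => latticeDensity ν (L n) (z0 n) (t n) (fun y => φ₁ y * φ₂ (f^[n] y)) z)
        atTop (𝓝 ((∫ y, φ₁ y ∂ν) * (∫ y, φ₂ y ∂ν) * p z)))
    {Φ : M → (Fin d → ℤ) → ℝ} (hm : ∀ w, Measurable fun y => Φ y w)
    {C : ℝ} (hC : ∀ y w, |Φ y w| ≤ C)
    {s : ℕ → M} (hs : ∀ᵐ x ∂ν, ∀ ε > 0, ∃ k, ∀ w, |Φ x w - Φ (s k) w| < ε) {b : ℝ}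
    (hav : ∀ ε > 0, ∃ V : Finset (Fin d → ℤ), V.Nonempty ∧
      ∀ w, |(∑ v ∈ V, ∫ y, Φ y (w + v) ∂ν) / V.card - b| ≤ ε)
    (ψ : BoundedContinuousFunction M ℝ) :
    Tendsto (fun n => ∫ y, ψ y * Φ (f^[n] y) (t n y) ∂ν) atTop (𝓝 ((∫ y, ψ y ∂ν) * b)) := by
  have hMne : Nonempty M := nonempty_of_isProbabilityMeasure ν
  have hC0 : 0 ≤ C := (abs_nonneg _).trans (hC hMne.some 0)
  have hpi : Integrable p := by
    by_contra hcon
    rw [integral_undef hcon] at hp1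
    exact zero_ne_one hp1
  have hfn : ∀ n, MeasurePreserving f^[n] ν ν := fun n => hf.iterate n
  have hΦm : Measurable fun x : M × (Fin d → ℤ) => Φ x.1 x.2 :=
    measurable_from_prod_countable_left hm
  have hΦi : ∀ w, Integrable (fun y => Φ y w) ν := fun w =>
    (integrable_const C).mono' (hm w).aestronglyMeasurable (ae_of_all _ fun y => hC y w)
  have hψi : Integrable ψ ν := ψ.integrable ν
  have hψ1 : |∫ y, ψ y ∂ν| ≤ ‖ψ‖ := by
    have := norm_integral_le_of_norm_le_const (μ := ν) (ae_of_all _ ψ.norm_coe_le_norm)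
    simpa using this
  let g : ℕ → (Fin d → ℝ) → Fin d → ℤ := fun n z => z0 n + fun i => ⌊z i * L n⌋
  have hgm : ∀ n, Measurable (g n) := fun n => measurable_add_floor _ _
  let H : (Fin d → ℤ) → ℝ := fun w => ∫ y, Φ y w ∂ν
  have hHC : ∀ w, |H w| ≤ C := fun w => by
    have := norm_integral_le_of_norm_le_const (μ := ν) (f := fun y => Φ y w) (C := C)
      (ae_of_all _ fun y => hC y w)
    simpa using this
  have hcp : ∀ n (c : (Fin d → ℤ) → ℝ), (∀ w, |c w| ≤ C) →
      Integrable fun z => c (g n z) * p z := fun n c hc =>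
    hpi.bdd_mul (c := C) ((measurable_of_countable c).comp (hgm n)).aestronglyMeasurable
      (ae_of_all _ fun z => hc _)
  have hHlim : Tendsto (fun n => ∫ z, H (g n z) * p z) atTop (𝓝 b) :=
    tendsto_integral_of_cube_averages hL z0 hpc hp0 hp1 hHC hav
  have hmain : Tendsto (fun n => ∫ y, ψ y * Φ (f^[n] y) (t n y) ∂ν -
      (∫ y, ψ y ∂ν) * ∫ z, H (g n z) * p z) atTop (𝓝 0) := by
    rw [Metric.tendsto_atTop]
    intro ε hε
    obtain ⟨η, hη, hηε⟩ : ∃ η > 0, 2 * ‖ψ‖ * η < ε := by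
      refine ⟨ε / (2 * ‖ψ‖ + 1), by positivity, ?_⟩
      rw [← mul_div_assoc, div_lt_iff₀ (by positivity)]
      nlinarith
    obtain ⟨K, χ, e, hei, he, hΦe⟩ := exists_sum_approx hm hC0 hC hs hη
    let D : ℕ → ℕ → ℝ := fun k n => ∫ y, (ψ y * χ k (f^[n] y)) * Φ (s k) (t n y) ∂ν -
      ((∫ y, ψ y ∂ν) * ∫ y, χ k y ∂ν) * ∫ z, Φ (s k) (g n z) * p z
    have hprod : ∀ k n, Integrable (fun y => ψ y * χ k (f^[n] y)) ν := fun k n =>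
      hψi.mul_bdd (c := ‖χ k‖)
        ((χ k).continuous.measurable.comp (hfn n).measurable).aestronglyMeasurable
        (ae_of_all _ fun y => (χ k).norm_coe_le_norm _)
    have hD : ∀ k, Tendsto (D k) atTop (𝓝 0) := fun k => by
      refine tendsto_integral_mul_comp_sub (C := ‖ψ‖ * ‖χ k‖) hL ht hp0 hp1 (fun z => ?_)
        (hprod k) (fun n y => ?_) (hM ψ (χ k)) (hC (s k))
      · simpa using hM (BoundedContinuousFunction.const M 1) (BoundedContinuousFunction.const M 1) z
      · rw [abs_mul]
        exact mul_le_mul (ψ.norm_coe_le_norm _) ((χ k).norm_coe_le_norm _) (abs_nonneg _)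
          (norm_nonneg _)
    have hDsum : Tendsto (fun n => ∑ k ∈ Finset.range K, D k n) atTop (𝓝 0) := by
      simpa using tendsto_finsetSum (Finset.range K) fun k _ => hD k
    obtain ⟨N, hN⟩ := Metric.tendsto_atTop.1 hDsum (ε - 2 * ‖ψ‖ * η) (by linarith)
    refine ⟨N, fun n hn => ?_⟩
    have hDn := hN n hn
    rw [Real.dist_0_eq_abs] at hDn ⊢
    have hsl : ∀ k, Integrable (fun y => (ψ y * χ k (f^[n] y)) * Φ (s k) (t n y)) ν := fun k =>
      (hprod k n).mul_bdd (c := C)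
        ((measurable_of_countable (Φ (s k))).comp (ht n)).aestronglyMeasurable
        (ae_of_all _ fun y => hC _ _)
    have hJi : Integrable (fun y => ψ y * Φ (f^[n] y) (t n y)) ν :=
      hψi.mul_bdd (c := C)
        (hΦm.comp ((hfn n).measurable.prodMk (ht n))).aestronglyMeasurable
        (ae_of_all _ fun y => hC _ _)
    have h1 : |∫ y, ψ y * Φ (f^[n] y) (t n y) ∂ν - ∑ k ∈ Finset.range K,
        ∫ y, (ψ y * χ k (f^[n] y)) * Φ (s k) (t n y) ∂ν| ≤ ‖ψ‖ * η := by
      rw [← integral_finsetSum _ fun k _ => hsl k,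
        ← integral_sub hJi (integrable_finsetSum _ fun k _ => hsl k), ← Real.norm_eq_abs]
      have hei' : Integrable (fun y => ‖ψ‖ * e (f^[n] y)) ν :=
        (((hfn n).integrable_comp hei.1).2 hei).const_mul _
      refine (norm_integral_le_of_norm_le hei' (ae_of_all _ fun y => ?_)).trans ?_
      · simp only [mul_assoc]
        rw [← Finset.mul_sum, ← mul_sub, norm_mul]
        exact mul_le_mul (ψ.norm_coe_le_norm _) (hΦe _ _) (norm_nonneg _) (norm_nonneg _)
      · have heq : ∫ y, e (f^[n] y) ∂ν = ∫ y, e y ∂ν := by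
          have hmap := (hfn n).map_eq
          have := integral_map (hfn n).measurable.aemeasurable (f := e)
            (by rw [hmap]; exact hei.1)
          rw [← this, hmap]
        rw [integral_const_mul, heq]
        exact mul_le_mul_of_nonneg_left he (norm_nonneg _)
    have h2 : |∑ k ∈ Finset.range K, (∫ y, χ k y ∂ν) * (∫ z, Φ (s k) (g n z) * p z) -
        ∫ z, H (g n z) * p z| ≤ η := by
      have hci : ∀ k, Integrable fun z => (∫ y, χ k y ∂ν) * (Φ (s k) (g n z) * p z) := fun k =>
        (hcp n _ (hC (s k))).const_mul _
      simp only [← integral_const_mul]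
      rw [← integral_finsetSum _ fun k _ => hci k,
        ← integral_sub (integrable_finsetSum _ fun k _ => hci k) (hcp n H hHC),
        ← Real.norm_eq_abs]
      refine (norm_integral_le_of_norm_le (hpi.const_mul η) (ae_of_all _ fun z => ?_)).trans ?_
      · simp only [← mul_assoc]
        rw [← Finset.sum_mul, ← sub_mul, norm_mul, Real.norm_of_nonneg (hp0 z)]
        refine mul_le_mul_of_nonneg_right ?_ (hp0 z)
        have hχi : ∀ k, Integrable (fun y => χ k y * Φ (s k) (g n z)) ν := fun k =>
          ((χ k).integrable ν).mul_const _
        simp only [← integral_mul_const, H]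
        rw [← integral_finsetSum _ fun k _ => hχi k,
          ← integral_sub (integrable_finsetSum _ fun k _ => hχi k) (hΦi _)]
        refine (norm_integral_le_of_norm_le hei (ae_of_all _ fun y => ?_)).trans he
        rw [norm_sub_rev]
        exact hΦe y _
      · rw [integral_const_mul, hp1, mul_one]
    have hsplit : ∫ y, ψ y * Φ (f^[n] y) (t n y) ∂ν - (∫ y, ψ y ∂ν) * ∫ z, H (g n z) * p z =
        (∫ y, ψ y * Φ (f^[n] y) (t n y) ∂ν - ∑ k ∈ Finset.range K,
          ∫ y, (ψ y * χ k (f^[n] y)) * Φ (s k) (t n y) ∂ν) + ∑ k ∈ Finset.range K, D k n +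
        (∫ y, ψ y ∂ν) * (∑ k ∈ Finset.range K, (∫ y, χ k y ∂ν) * (∫ z, Φ (s k) (g n z) * p z) -
          ∫ z, H (g n z) * p z) := by
      simp only [D, Finset.sum_sub_distrib, mul_sub, Finset.mul_sum, mul_assoc]
      ring
    rw [hsplit]
    refine (abs_add_three _ _ _).trans_lt ?_
    have h3 := mul_le_mul hψ1 h2 (abs_nonneg _) (norm_nonneg ψ)
    rw [abs_mul]
    linarith
  have := hmain.add (hHlim.const_mul (∫ y, ψ y ∂ν))
  simpa using this

theorem tendsto_integral_mul_of_forall_boundedContinuous {M : Type*} [MetricSpace M]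
    [MeasurableSpace M] [BorelSpace M] {ν : Measure M} [IsFiniteMeasure ν]
    {G : ℕ → M → ℝ} (hG : ∀ n, Measurable (G n)) {C b : ℝ} (hC0 : 0 ≤ C) (hC : ∀ n y, |G n y| ≤ C)
    (hb : |b| ≤ C)
    (hlim : ∀ ψ : BoundedContinuousFunction M ℝ,
      Tendsto (fun n => ∫ y, ψ y * G n y ∂ν) atTop (𝓝 ((∫ y, ψ y ∂ν) * b)))
    {ψ : M → ℝ} (hψ : Integrable ψ ν) :
    Tendsto (fun n => ∫ y, ψ y * G n y ∂ν) atTop (𝓝 ((∫ y, ψ y ∂ν) * b)) := by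
  rw [Metric.tendsto_atTop]
  intro ε hε
  obtain ⟨η, hη, hηε⟩ : ∃ η > 0, 2 * C * η < ε := by
    refine ⟨ε / (2 * C + 1), by positivity, ?_⟩
    rw [← mul_div_assoc, div_lt_iff₀ (by positivity)]
    nlinarith
  obtain ⟨χ, hχ, hχi⟩ := hψ.exists_boundedContinuous_integral_sub_le hη
  obtain ⟨N, hN⟩ := Metric.tendsto_atTop.1 (hlim χ) (ε - 2 * C * η) (by linarith)
  refine ⟨N, fun n hn => ?_⟩
  have hn' := hN n hn
  rw [Real.dist_eq] at hn' ⊢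
  have hGi : ∀ {θ : M → ℝ}, Integrable θ ν → Integrable (fun y => θ y * G n y) ν := fun hθ =>
    hθ.mul_bdd (c := C) (hG n).aestronglyMeasurable (ae_of_all _ (hC n))
  have hd : Integrable (fun y => ‖ψ y - χ y‖) ν := (hψ.sub hχi).norm
  have h1 : |∫ y, ψ y * G n y ∂ν - ∫ y, χ y * G n y ∂ν| ≤ C * η := by
    rw [← integral_sub (hGi hψ) (hGi hχi), ← Real.norm_eq_abs]
    refine (norm_integral_le_of_norm_le (hd.const_mul C) (ae_of_all _ fun y => ?_)).trans ?_
    · rw [← sub_mul, norm_mul, mul_comm]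
      exact mul_le_mul_of_nonneg_right (hC n y) (norm_nonneg _)
    · rw [integral_const_mul]
      exact mul_le_mul_of_nonneg_left hχ hC0
  have h2 : |(∫ y, χ y ∂ν) * b - (∫ y, ψ y ∂ν) * b| ≤ η * C := by
    rw [← sub_mul, abs_mul, ← integral_sub hχi hψ, ← Real.norm_eq_abs]
    refine mul_le_mul ((norm_integral_le_of_norm_le hd (ae_of_all _ fun y => ?_)).trans hχ) hb
      (abs_nonneg _) hη.le
    rw [norm_sub_rev]
  calc |∫ y, ψ y * G n y ∂ν - (∫ y, ψ y ∂ν) * b|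
      = |(∫ y, ψ y * G n y ∂ν - ∫ y, χ y * G n y ∂ν) +
          (∫ y, χ y * G n y ∂ν - (∫ y, χ y ∂ν) * b) +
          ((∫ y, χ y ∂ν) * b - (∫ y, ψ y ∂ν) * b)| := by ring_nf
    _ ≤ _ := abs_add_three _ _ _
    _ < ε := by linarith

theorem measurable_tauSum {d : ℕ} {M : Type*} [MeasurableSpace M] {f : M → M} (hf : Measurable f)
    {τ : M → Fin d → ℤ} (hτ : Measurable τ) (n : ℕ) : Measurable (tauSum f τ n) :=
  Finset.measurable_sum _ fun j _ => hτ.comp (hf.iterate j)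

theorem skewT_iterate {d : ℕ} {M : Type*} (f : M → M) (τ : M → Fin d → ℤ) (n : ℕ) (y : M)
    (z : Fin d → ℤ) : (skewT f τ)^[n] (y, z) = (f^[n] y, z + tauSum f τ n y) := by
  induction n with
  | zero => simp [tauSum]
  | succ n ih =>
    rw [Function.iterate_succ_apply', ih, Function.iterate_succ_apply']
    simp [skewT, tauSum, Finset.sum_range_succ, add_assoc]

theorem UniformContinuous.measurable_prod_lattice {d : ℕ} {M : Type*} [MetricSpace M]
    [MeasurableSpace M] [BorelSpace M] {Φ : M × (Fin d → ℤ) → ℝ} (hΦ : UniformContinuous Φ) :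
    Measurable Φ :=
  measurable_from_prod_countable_left fun w =>
    (hΦ.continuous.comp (Continuous.prodMk_left w)).measurable

theorem vcube_intCast_eq {d : ℕ} (M : Type*) (w : Fin d → ℤ) (N : ℕ) :
    VCube M (fun i => (w i : ℝ)) N = Set.univ ×ˢ
      (((Fintype.piFinset fun _ => Finset.Icc (0 : ℤ) N).map (addLeftEmbedding w) :
        Finset (Fin d → ℤ)) : Set (Fin d → ℤ)) := by
  ext ⟨y, v⟩
  simp only [VCube, VBox, Set.mem_ofPred_eq, Set.mem_prod, Set.mem_univ, true_and,
    Finset.mem_coe, Finset.mem_map, Fintype.mem_piFinset, Finset.mem_Icc, addLeftEmbedding_apply]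
  constructor
  · intro h
    refine ⟨v - w, fun i => ?_, by simp⟩
    obtain ⟨h1, h2⟩ := h i
    have h2' : v i ≤ w i + N := by exact_mod_cast h2
    have h1' : w i ≤ v i := by exact_mod_cast h1
    simp only [Pi.sub_apply]
    constructor <;> linarith
  · rintro ⟨u, hu, rfl⟩ i
    obtain ⟨h1, h2⟩ := hu i
    constructor
    · have : w i ≤ w i + u i := by linarith
      exact_mod_cast this
    · have : w i + u i ≤ w i + N := by linarith
      exact_mod_cast this

theorem exists_finset_average_of_memGU {d : ℕ} {M : Type*} [MetricSpace M] [MeasurableSpace M]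
    [BorelSpace M] {ν : Measure M} [IsProbabilityMeasure ν] {Φ : M × (Fin d → ℤ) → ℝ} {b : ℝ}
    (hΦ : memGU (skewMeas ν) Φ b) {ε : ℝ} (hε : 0 < ε) :
    ∃ V : Finset (Fin d → ℤ), V.Nonempty ∧
      ∀ w, |(∑ v ∈ V, ∫ y, Φ (y, w + v) ∂ν) / V.card - b| ≤ ε := by
  obtain ⟨⟨C, hC⟩, hU, hav⟩ := hΦ
  obtain ⟨N₀, hN₀⟩ := hav ε hε
  obtain ⟨N, hN⟩ := exists_nat_ge N₀
  refine ⟨Fintype.piFinset fun _ => Finset.Icc (0 : ℤ) N,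
    ⟨0, Fintype.mem_piFinset.2 fun _ => Finset.mem_Icc.2 ⟨le_rfl, by positivity⟩⟩, fun w => ?_⟩
  have h := hN₀ (fun i => (w i : ℝ)) N hN
  rw [vcube_intCast_eq] at h
  set V : Finset (Fin d → ℤ) := Fintype.piFinset fun _ => Finset.Icc (0 : ℤ) N
  have hS : (Measure.count : Measure (Fin d → ℤ)) (V.map (addLeftEmbedding w) : Finset _) =
      V.card := by
    rw [Measure.count_apply_finset, Finset.card_map]
  have hμ : (skewMeas ν (Set.univ ×ˢ ((V.map (addLeftEmbedding w) : Finset (Fin d → ℤ)) :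
      Set (Fin d → ℤ)))).toReal = V.card := by
    rw [skewMeas, Measure.prod_prod, hS, measure_univ, one_mul, ENNReal.toReal_natCast]
  have hint : ∫ x in Set.univ ×ˢ ((V.map (addLeftEmbedding w) : Finset (Fin d → ℤ)) :
      Set (Fin d → ℤ)), Φ x ∂skewMeas ν = ∑ v ∈ V, ∫ y, Φ (y, w + v) ∂ν := by
    have : IsFiniteMeasure ((Measure.count : Measure (Fin d → ℤ)).restrict
        ((V.map (addLeftEmbedding w) : Finset (Fin d → ℤ)) : Set (Fin d → ℤ))) :=
      ⟨by rw [Measure.restrict_apply_univ, hS]; exact ENNReal.natCast_lt_top _⟩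
    rw [skewMeas, ← Measure.prod_restrict, Measure.restrict_univ, integral_prod_symm,
      setIntegral_finset]
    · simp [Finset.sum_map, Measure.real]
    · exact Integrable.of_bound Measurable.of_discrete.aestronglyMeasurable C
        (ae_of_all _ fun v => (norm_integral_le_of_norm_le_const (ae_of_all ν fun y =>
          hC (y, v))).trans_eq (by simp))
    · exact Integrable.of_bound hU.measurable_prod_lattice.aestronglyMeasurable C
        (ae_of_all _ hC)
  rw [hμ, hint, inv_mul_eq_div] at h
  exact h

theorem ShiftedMLLT.tendsto_latticeDensity {d : ℕ} {M : Type*} [MetricSpace M] [MeasurableSpace M]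
    {ν : Measure M} {f : M → M} {τ : M → Fin d → ℤ} {L : ℕ → ℝ} {p : (Fin d → ℝ) → ℝ}
    (h : ShiftedMLLT ν f τ L p) :
    ∃ z0 : ℕ → Fin d → ℤ, ∀ (φ₁ φ₂ : BoundedContinuousFunction M ℝ) (z : Fin d → ℝ),
      Tendsto (fun n => latticeDensity ν (L n) (z0 n) (tauSum f τ n)
        (fun y => φ₁ y * φ₂ (f^[n] y)) z) atTop (𝓝 ((∫ y, φ₁ y ∂ν) * (∫ y, φ₂ y ∂ν) * p z)) := by
  obtain ⟨hL, -, -, -, D, hD⟩ := h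
  refine ⟨fun n i => ⌊D n i⌋, fun φ₁ φ₂ z => ?_⟩
  have hz0 : Tendsto (fun n => fun i => (((⌊D n i⌋ : ℤ) : ℝ) - D n i) / L n) atTop (𝓝 0) := by
    refine tendsto_pi_nhds.2 fun i => ?_
    refine squeeze_zero_norm' (a := fun n => (L n)⁻¹) ?_ hL.inv_tendsto_atTop
    filter_upwards [hL.eventually_gt_atTop 0] with n hn
    rw [norm_div, Real.norm_of_nonneg hn.le, div_eq_mul_inv]
    refine mul_le_of_le_one_left (inv_nonneg.2 hn.le) ?_
    rw [Real.norm_eq_abs, abs_le]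
    constructor <;> linarith [Int.floor_le (D n i), Int.lt_floor_add_one (D n i)]
  refine Metric.tendsto_atTop.2 fun ε hε => ?_
  obtain ⟨N, hN⟩ := hD φ₁ φ₂ φ₁.continuous φ₂.continuous ⟨‖φ₁‖, φ₁.norm_coe_le_norm⟩
    ⟨‖φ₂‖, φ₂.norm_coe_le_norm⟩ _ hz0 (rnorm z) (ε / 2) (half_pos hε)
  exact ⟨N, fun n hn => (hN n hn z le_rfl).trans_lt (half_lt_self hε)⟩

theorem exists_iterate_mem_of_tendsto_latticeDensity {d : ℕ} {M : Type*} [MetricSpace M]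
    [MeasurableSpace M] [BorelSpace M] {ν : Measure M} [IsProbabilityMeasure ν] {f : M → M}
    {L : ℕ → ℝ} {z0 : ℕ → Fin d → ℤ} {t : ℕ → M → Fin d → ℤ} {p : (Fin d → ℝ) → ℝ}
    (hp : p ≠ 0)
    (hM : ∀ (φ₁ φ₂ : BoundedContinuousFunction M ℝ) (z : Fin d → ℝ),
      Tendsto (fun n => latticeDensity ν (L n) (z0 n) (t n) (fun y => φ₁ y * φ₂ (f^[n] y)) z)
        atTop (𝓝 ((∫ y, φ₁ y ∂ν) * (∫ y, φ₂ y ∂ν) * p z)))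
    {A B : Set M} (hA : IsClopen A) (hB : IsClopen B) (hνA : ν A ≠ 0) (hνB : ν B ≠ 0) :
    ∃ n, ∃ x ∈ A, f^[n] x ∈ B := by
  by_contra! hAB
  obtain ⟨z, hz⟩ := Function.ne_iff.1 hp
  have h := hM (BoundedContinuousFunction.indicator A hA)
    (BoundedContinuousFunction.indicator B hB) z
  have h0 : ∀ n y, A.indicator (1 : M → ℝ) y * B.indicator 1 (f^[n] y) = 0 := fun n y => by
    by_cases hy : y ∈ A
    · simp [hAB n y hy]
    · simp [hy]
  simp only [BoundedContinuousFunction.indicator_apply, h0, latticeDensity, ite_self,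
    integral_zero, mul_zero] at h
  have h1 := tendsto_nhds_unique h tendsto_const_nhds
  rw [integral_indicator_one hA.isOpen.measurableSet,
    integral_indicator_one hB.isOpen.measurableSet] at h1
  simp only [mul_eq_zero] at h1
  rcases h1 with (h1 | h1) | h1
  exacts [hνA ((measureReal_eq_zero_iff).1 h1), hνB ((measureReal_eq_zero_iff).1 h1), hz h1]

theorem tendsto_integral_skew_of_forall_slice {d : ℕ} {M : Type*} [MeasurableSpace M]
    {ν : Measure M} [IsProbabilityMeasure ν] {T : ℕ → M × (Fin d → ℤ) → M × (Fin d → ℤ)}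
    (hT : ∀ n, Measurable (T n)) {φ Φ : M × (Fin d → ℤ) → ℝ} (hφ : Integrable φ (skewMeas ν))
    (hΦ : Measurable Φ) {C b : ℝ} (hC : ∀ x, |Φ x| ≤ C)
    (h : ∀ z, Integrable (fun y => φ (y, z)) ν →
      Tendsto (fun n => ∫ y, φ (y, z) * Φ (T n (y, z)) ∂ν) atTop (𝓝 ((∫ y, φ (y, z) ∂ν) * b))) :
    Tendsto (fun n => ∫ x, φ x * Φ (T n x) ∂skewMeas ν) atTop
      (𝓝 ((∫ x, φ x ∂skewMeas ν) * b)) := by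
  have hslice : ∀ z, Integrable (fun y => φ (y, z)) ν := fun z => by
    have := Integrable.prod_left_ae (μ := ν) (ν := Measure.count) hφ
    exact Measure.ae_count_iff.1 this z
  have hi : ∀ n, Integrable (fun x => φ x * Φ (T n x)) (skewMeas ν) := fun n =>
    hφ.mul_bdd (c := C) (hΦ.comp (hT n)).aestronglyMeasurable (ae_of_all _ fun x => hC _)
  rw [← integral_mul_const]
  simp only [skewMeas] at hi hφ ⊢
  rw [integral_prod_symm _ (hφ.mul_const b)]
  simp_rw [fun n => integral_prod_symm _ (hi n)]
  refine tendsto_integral_of_dominated_convergence (fun z => (∫ y, ‖φ (y, z)‖ ∂ν) * C)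
    (fun n => (Measurable.of_discrete).aestronglyMeasurable)
    (hφ.integral_norm_prod_right.mul_const C) (fun n => ae_of_all _ fun z => ?_)
    (ae_of_all _ fun z => by simpa only [integral_mul_const] using h z (hslice z))
  rw [← integral_mul_const]
  refine norm_integral_le_of_norm_le ((hslice z).norm.mul_const C) (ae_of_all _ fun y => ?_)
  rw [norm_mul]
  exact mul_le_mul_of_nonneg_left (hC _) (norm_nonneg _)

/-- If the skew product `T(y,z) = (f y, z + τ y)` satisfies a shifted MLLT at
some scale `(L_n)`, then `T` is local-global mixing with respect to `𝔾_U`: for every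
`φ ∈ L¹(μ)` and every `(Φ, Φ̄) ∈ 𝔾_U`, `∫ φ · (Φ ∘ T^n) dμ → (∫ φ dμ) · Φ̄`. -/
theorem shifted_mllt_implies_local_global_mixing_GU
    {d : ℕ} {M : Type*} [MetricSpace M] [LocallyCompactSpace M]
    [MeasurableSpace M] [BorelSpace M]
    (ν : Measure M) [IsProbabilityMeasure ν]
    (f : M → M) (hf : MeasurePreserving f ν ν)
    (τ : M → Fin d → ℤ) (hτ : Measurable τ)
    (L : ℕ → ℝ) (p : (Fin d → ℝ) → ℝ)
    (hMLLT : ShiftedMLLT ν f τ L p)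
    (φ : M × (Fin d → ℤ) → ℝ) (hφ : Integrable φ (skewMeas ν))
    (Φ : M × (Fin d → ℤ) → ℝ) (Φbar : ℝ) (hΦ : memGU (skewMeas ν) Φ Φbar) :
    Tendsto (fun n : ℕ => ∫ x, φ x * Φ ((skewT f τ)^[n] x) ∂(skewMeas ν))
      atTop (𝓝 ((∫ x, φ x ∂(skewMeas ν)) * Φbar)) := by
  obtain ⟨z0, hM⟩ := hMLLT.tendsto_latticeDensity
  obtain ⟨hL, hpc, hp0, hp1, -⟩ := hMLLT
  have hav := fun (ε : ℝ) (hε : 0 < ε) => exists_finset_average_of_memGU hΦ hε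
  obtain ⟨⟨C, hC⟩, hU, -⟩ := hΦ
  have hΦm := hU.measurable_prod_lattice
  have hf' := hf.measurable
  have hp : p ≠ 0 := by
    rintro rfl
    simp at hp1
  obtain ⟨s, hs⟩ := exists_seq_ae_approx ν hf'
    (fun A B hA hB => exists_iterate_mem_of_tendsto_latticeDensity hp hM hA hB)
    (fun y w => Φ (y, w)) fun ε hε => by
      obtain ⟨δ, hδ, h⟩ := Metric.uniformContinuous_iff.1 hU ε hε
      refine ⟨δ, hδ, fun x y hxy w => h ?_⟩
      simpa [Prod.dist_eq, hδ] using hxy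
  have hT : ∀ n, Measurable ((skewT f τ)^[n]) := fun n =>
    Measurable.iterate ((hf'.comp measurable_fst).prodMk
      (measurable_snd.add (hτ.comp measurable_fst))) n
  refine tendsto_integral_skew_of_forall_slice hT hφ hΦm hC fun z hz => ?_
  simp only [skewT_iterate]
  have hm : ∀ w, Measurable fun y => Φ (y, z + w) := fun w => hΦm.comp measurable_prodMk_right
  have ht := measurable_tauSum hf' hτ
  refine tendsto_integral_mul_of_forall_boundedContinuous (C := max C |Φbar|)
    (fun n => hΦm.comp ((hf'.iterate n).prodMk (measurable_const.add (ht n))))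
    ((abs_nonneg _).trans (le_max_right _ _)) (fun n y => (hC _).trans (le_max_left _ _))
    (le_max_right _ _) (fun ψ => ?_) hz
  refine tendsto_integral_boundedContinuous_mul hf hL ht hpc hp0 hp1 hM
    (Φ := fun y w => Φ (y, z + w)) hm (fun y w => hC _) (s := s) ?_ (fun ε hε => ?_) ψ
  · filter_upwards [hs] with x hx ε hε
    obtain ⟨k, hk⟩ := hx ε hε
    exact ⟨k, fun w => hk (z + w)⟩
  · obtain ⟨V, hV, h⟩ := hav ε hε
    refine ⟨V, hV, fun w => ?_⟩
    simpa only [add_assoc] using h (z + w)
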